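/- Let δ ∈ [1,2) and assume Hess V is bounded below (as quadratic forms). If W₂(ν,μ)² ≤ C I(ν|μ)^{(2−δ)/δ} holds for all probability measures ν on ℝⁿ, then there exists a constant C' > 0 such that μ(g² log g²)^δ ≤ C' μ(|∇g|²) for all g ∈ C¹_b(ℝⁿ) with μ(g²) = 1. -/

import Mathlib

open MeasureTheory ENNReal NNReal Classical

/-- A coupling of `ν` and `μ`. -/
def IsCoupling {n : ℕ}
    (π : Measure (EuclideanSpace ℝ (Fin n) × EuclideanSpace ℝ (Fin n)))
    (ν μ : Measure (EuclideanSpace ℝ (Fin n))) : Prop :=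
  π.map Prod.fst = ν ∧ π.map Prod.snd = μ

/-- The `L^p`-Wasserstein distance for the Euclidean distance. -/
noncomputable def wassersteinDist {n : ℕ} (p : ℝ)
    (ν μ : Measure (EuclideanSpace ℝ (Fin n))) : ℝ≥0∞ :=
  (⨅ (π : Measure (EuclideanSpace ℝ (Fin n) × EuclideanSpace ℝ (Fin n)))
      (_ : IsCoupling π ν μ), ∫⁻ q, edist q.1 q.2 ^ p ∂π) ^ (1 / p)

/-- The relative entropy (Kullback information) `H(ν|μ)`. -/
noncomputable def relEntropy {n : ℕ}
    (ν μ : Measure (EuclideanSpace ℝ (Fin n))) : ℝ≥0∞ :=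
  if ν ≪ μ ∧ Integrable (llr ν μ) ν then ENNReal.ofReal (∫ x, llr ν μ x ∂ν) else ⊤

/-- The Fisher information `I(ν|μ) = ∫ |∇√f|² dμ` for `ν = fμ` with `√f ∈ H¹(μ)`,
and `+∞` otherwise. -/
noncomputable def fisherInfo {n : ℕ}
    (ν μ : Measure (EuclideanSpace ℝ (Fin n))) : ℝ≥0∞ :=
  ⨅ (f : EuclideanSpace ℝ (Fin n) → ℝ) (_ : ∀ x, 0 ≤ f x)
    (_ : ν = μ.withDensity fun x => ENNReal.ofReal (f x))
    (_ : Differentiable ℝ fun x => Real.sqrt (f x)),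
    ∫⁻ x, (‖gradient (fun y => Real.sqrt (f y)) x‖₊ : ℝ≥0∞) ^ 2 ∂μ

/-- The volume of a compact Minkowski sum on the line. -/
theorem volume_add_le_of_isCompact {K L S : Set ℝ} (hK : IsCompact K) (hL : IsCompact L)
    (hK0 : K.Nonempty) (hL0 : L.Nonempty) (h : ∀ x ∈ K, ∀ y ∈ L, x + y ∈ S) :
    volume K + volume L ≤ volume S := by
  have hk := hK.isGreatest_sSup hK0
  have hl := hL.isLeast_sInf hL0
  set a := sSup K
  set b := sInf L
  have hA : MeasurableSet ((fun x => x + b) '' K) :=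
    (hK.image (by fun_prop)).measurableSet
  have hvK : volume ((fun x => x + b) '' K) = volume K := by simp
  have hvL : volume ((fun y => a + y) '' L) = volume L := by simp
  have hinter : volume ((fun x => x + b) '' K ∩ (fun y => a + y) '' L) = 0 := by
    refine measure_mono_null ?_ (measure_singleton (a + b))
    rintro z ⟨⟨x, hx, rfl⟩, ⟨y, hy, hxy⟩⟩
    have h1 := hk.2 hx
    have h2 := hl.2 hy
    simp only [Set.mem_singleton_iff] at *
    linarith
  rw [← hvK, ← hvL, ← measure_union_add_inter' hA, hinter, add_zero]
  refine measure_mono ?_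
  rintro z (⟨x, hx, rfl⟩ | ⟨y, hy, rfl⟩)
  · exact h x hx b hl.1
  · exact h a hk.1 y hy

/-- A measurable nonempty set has its volume approximated by nonempty compact subsets. -/
theorem exists_isCompact_nonempty_volume_ge {A : Set ℝ} (hA : MeasurableSet A)
    {r : ℝ≥0∞} (hr : r < volume A) :
    ∃ K ⊆ A, IsCompact K ∧ K.Nonempty ∧ r ≤ volume K := by
  obtain ⟨K, hKA, hK, hrK⟩ := hA.exists_lt_isCompact hr
  refine ⟨K, hKA, hK, ?_, hrK.le⟩
  by_contra h
  rw [Set.not_nonempty_iff_eq_empty] at h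
  simp [h] at hrK

/-- The Brunn–Minkowski inequality on the line. -/
theorem volume_add_le {A B S : Set ℝ} (hA : MeasurableSet A) (hB : MeasurableSet B)
    (hA0 : A.Nonempty) (hB0 : B.Nonempty) (h : ∀ x ∈ A, ∀ y ∈ B, x + y ∈ S) :
    volume A + volume B ≤ volume S := by
  have key : ∀ {A : Set ℝ}, MeasurableSet A → A.Nonempty → ∀ c : ℝ≥0∞,
      (∀ K ⊆ A, IsCompact K → K.Nonempty → volume K + c ≤ volume S) → volume A + c ≤ volume S := by
    intro A hA hA0 c hc
    rcases eq_or_ne (volume A) 0 with h0 | h0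
    · obtain ⟨x, hx⟩ := hA0
      have := hc {x} (by simpa using hx) isCompact_singleton (by simp)
      simpa [h0] using this
    · refine le_of_forall_lt fun z hz => ?_
      obtain ⟨r, hr, hz'⟩ : ∃ r < volume A, z < r + c := by
        by_contra! hcon
        have : volume A + c ≤ z := by
          have h1 : ⨆ r : Set.Iio (volume A), ((r : ℝ≥0∞) + c) ≤ z :=
            iSup_le fun r => hcon r r.2
          have : Nonempty (Set.Iio (volume A)) := ⟨⟨0, pos_iff_ne_zero.2 h0⟩⟩
          rw [← ENNReal.iSup_add] at h1
          have h2 : ⨆ r : Set.Iio (volume A), (r : ℝ≥0∞) = volume A := by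
            refine le_antisymm (iSup_le fun r => r.2.le) ?_
            refine le_of_forall_lt fun w hw => ?_
            obtain ⟨w', h1, h2⟩ := exists_between hw
            exact h1.trans_le (le_iSup (fun r : Set.Iio (volume A) => (r : ℝ≥0∞)) ⟨w', h2⟩)
          rwa [h2] at h1
        exact absurd hz (not_lt.2 this)
      obtain ⟨K, hKA, hK, hK0, hrK⟩ := exists_isCompact_nonempty_volume_ge hA hr
      exact hz'.trans_le ((add_le_add_left hrK c).trans (hc K hKA hK hK0))
  refine key hA hA0 _ fun K hKA hK hK0 => ?_
  rw [add_comm]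
  refine key hB hB0 _ fun L hLB hL hL0 => ?_
  rw [add_comm]
  exact volume_add_le_of_isCompact hK hL hK0 hL0 fun x hx y hy => h x (hKA hx) y (hLB hy)

theorem ENNReal.rpow_mul_rpow_le_weighted {t : ℝ} (ht0 : 0 < t) (ht1 : t < 1) (p q : ℝ≥0∞) :
    p ^ (1 - t) * q ^ t ≤ ENNReal.ofReal (1 - t) * p + ENNReal.ofReal t * q := by
  have h1 : 0 < 1 - t := by linarith
  have hc : (1 / (1 - t)).HolderConjugate (1 / t) := by
    rw [Real.holderConjugate_iff]
    refine ⟨by rw [lt_div_iff₀ h1]; linarith, by simp⟩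
  have := ENNReal.young_inequality (p ^ (1 - t)) (q ^ t) hc
  rw [← ENNReal.rpow_mul, ← ENNReal.rpow_mul, mul_one_div_cancel h1.ne',
    mul_one_div_cancel ht0.ne', ENNReal.rpow_one, ENNReal.rpow_one, one_div, one_div,
    ENNReal.ofReal_inv_of_pos h1, ENNReal.ofReal_inv_of_pos ht0, div_eq_mul_inv, inv_inv,
    div_eq_mul_inv, inv_inv, mul_comm p, mul_comm q] at this
  exact this

open scoped Pointwise in
/-- The weighted Brunn–Minkowski inequality on the line. -/
theorem volume_weighted_add_le {t : ℝ} (ht0 : 0 < t) (ht1 : t < 1) {A B S : Set ℝ}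
    (hA : MeasurableSet A) (hB : MeasurableSet B) (hA0 : A.Nonempty) (hB0 : B.Nonempty)
    (h : ∀ x ∈ A, ∀ y ∈ B, (1 - t) * x + t * y ∈ S) :
    ENNReal.ofReal (1 - t) * volume A + ENNReal.ofReal t * volume B ≤ volume S := by
  have h1 : 0 < 1 - t := by linarith
  have hs : ∀ {c : ℝ}, 0 < c → ∀ A : Set ℝ,
      volume (c • A) = ENNReal.ofReal c * volume A := by
    intro c hc A
    rw [Measure.addHaar_smul]
    simp [abs_of_pos hc]
  rw [← hs h1, ← hs ht0]
  refine volume_add_le (hA.const_smul₀ _) (hB.const_smul₀ _) hA0.smul_set hB0.smul_set ?_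
  rintro _ ⟨x, hx, rfl⟩ _ ⟨y, hy, rfl⟩
  exact h x hx y hy

/-- The one-dimensional Prékopa–Leindler inequality for functions with supremum one. -/
theorem lintegral_weighted_le_of_sup_one {t : ℝ} (ht0 : 0 < t) (ht1 : t < 1) {f g h : ℝ → ℝ}
    (hf : Measurable f) (hg : Measurable g) (hh : Measurable h)
    (hf0 : ∀ x, 0 ≤ f x) (hg0 : ∀ x, 0 ≤ g x) (hh0 : ∀ x, 0 ≤ h x)
    (hf1 : ∀ x, f x ≤ 1) (hg1 : ∀ x, g x ≤ 1)
    (hfs : ∀ s < 1, ∃ x, s < f x) (hgs : ∀ s < 1, ∃ x, s < g x)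
    (H : ∀ x y, f x ^ (1 - t) * g y ^ t ≤ h ((1 - t) * x + t * y)) :
    ENNReal.ofReal (1 - t) * (∫⁻ x, ENNReal.ofReal (f x)) +
      ENNReal.ofReal t * (∫⁻ x, ENNReal.ofReal (g x)) ≤ ∫⁻ x, ENNReal.ofReal (h x) := by
  have h1 : 0 < 1 - t := by linarith
  rw [lintegral_eq_lintegral_meas_lt volume (Filter.Eventually.of_forall hf0) hf.aemeasurable,
    lintegral_eq_lintegral_meas_lt volume (Filter.Eventually.of_forall hg0) hg.aemeasurable,
    lintegral_eq_lintegral_meas_lt volume (Filter.Eventually.of_forall hh0) hh.aemeasurable,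
    ← lintegral_const_mul' _ _ ofReal_ne_top, ← lintegral_const_mul' _ _ ofReal_ne_top]
  refine (le_lintegral_add _ _).trans ?_
  refine setLIntegral_mono' measurableSet_Ioi fun s hs => ?_
  simp only [Set.mem_Ioi] at hs
  rcases lt_or_ge s 1 with hs1 | hs1
  · refine volume_weighted_add_le ht0 ht1 (measurableSet_lt measurable_const hf)
      (measurableSet_lt measurable_const hg) (hfs s hs1) (hgs s hs1) ?_
    intro x hx y hy
    simp only [Set.mem_ofPred_eq] at *
    refine lt_of_lt_of_le ?_ (H x y)
    calc s = s ^ (1 - t) * s ^ t := by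
          rw [← Real.rpow_add hs]; simp
      _ < f x ^ (1 - t) * g y ^ t := by
          have := Real.rpow_pos_of_pos hs (1 - t)
          have := Real.rpow_pos_of_pos hs t
          have := Real.rpow_lt_rpow hs.le hx h1
          have := Real.rpow_lt_rpow hs.le hy ht0
          nlinarith
  · have e1 : {a | s < f a} = ∅ := by
      ext x; simpa using (hf1 x).trans hs1
    have e2 : {a | s < g a} = ∅ := by
      ext x; simpa using (hg1 x).trans hs1
    simp [e1, e2]

/-- The one-dimensional Prékopa–Leindler inequality for bounded functions. -/
theorem prekopa_leindler_real_bounded {t : ℝ} (ht0 : 0 < t) (ht1 : t < 1) {f g h : ℝ → ℝ≥0∞}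
    (hf : Measurable f) (hg : Measurable g) (hh : Measurable h)
    {M : ℝ≥0∞} (hM : M ≠ ∞) (hfM : ∀ x, f x ≤ M) (hgM : ∀ x, g x ≤ M)
    (H : ∀ x y, f x ^ (1 - t) * g y ^ t ≤ h ((1 - t) * x + t * y)) :
    (∫⁻ x, f x) ^ (1 - t) * (∫⁻ x, g x) ^ t ≤ ∫⁻ x, h x := by
  have h1 : 0 < 1 - t := by linarith
  set a := ⨆ x, f x with ha
  set b := ⨆ x, g x with hb
  have haM : a ≠ ∞ := ((iSup_le hfM).trans_lt hM.lt_top).ne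
  have hbM : b ≠ ∞ := ((iSup_le hgM).trans_lt hM.lt_top).ne
  rcases eq_or_ne a 0 with ha0 | ha0
  · have : ∀ x, f x = 0 := fun x => le_antisymm (ha0 ▸ le_iSup f x) bot_le
    simp [this, h1]
  rcases eq_or_ne b 0 with hb0 | hb0
  · have : ∀ x, g x = 0 := fun x => le_antisymm (hb0 ▸ le_iSup g x) bot_le
    simp [this, ht0]
  set c := a ^ (1 - t) * b ^ t with hc
  have hc0 : c ≠ 0 := by
    simp [hc, ENNReal.rpow_eq_zero_iff, ha0, hb0, haM, hbM]
  have hcM : c ≠ ∞ := ENNReal.mul_ne_top (ENNReal.rpow_ne_top_of_nonneg h1.le haM)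
    (ENNReal.rpow_ne_top_of_nonneg ht0.le hbM)
  have fle : ∀ x, f x / a ≤ 1 := fun x => ENNReal.div_le_of_le_mul (by simpa using le_iSup f x)
  have gle : ∀ x, g x / b ≤ 1 := fun x => ENNReal.div_le_of_le_mul (by simpa using le_iSup g x)
  have ft : ∀ x, f x / a ≠ ∞ := fun x => ((fle x).trans_lt one_lt_top).ne
  have gt : ∀ x, g x / b ≠ ∞ := fun x => ((gle x).trans_lt one_lt_top).ne
  have ht : ∀ x, min (h x / c) 1 ≠ ∞ := fun x => ((min_le_right _ _).trans_lt one_lt_top).ne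
  have sup_lem : ∀ (f : ℝ → ℝ≥0∞), (⨆ x, f x) ≠ 0 → (⨆ x, f x) ≠ ∞ →
      (∀ x, f x / (⨆ x, f x) ≠ ∞) → ∀ s < 1, ∃ x, s < (f x / (⨆ x, f x)).toReal := by
    intro f h0 hT hft s hs
    have : ENNReal.ofReal s * (⨆ x, f x) < ⨆ x, f x := by
      conv_rhs => rw [← one_mul (⨆ x, f x)]
      exact ENNReal.mul_lt_mul_left h0 hT (by simpa using hs)
    obtain ⟨x, hx⟩ := lt_iSup_iff.1 this
    refine ⟨x, ?_⟩
    rcases lt_or_ge s 0 with hs0 | hs0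
    · exact hs0.trans_le toReal_nonneg
    rw [← ENNReal.ofReal_lt_iff_lt_toReal hs0 (hft x)]
    exact (ENNReal.lt_div_iff_mul_lt (Or.inl h0) (Or.inl hT)).2 hx
  have key := lintegral_weighted_le_of_sup_one ht0 ht1 (f := fun x => (f x / a).toReal)
    (g := fun x => (g x / b).toReal) (h := fun x => (min (h x / c) 1).toReal)
    (by fun_prop) (by fun_prop) (by fun_prop) (fun _ => toReal_nonneg) (fun _ => toReal_nonneg)
    (fun _ => toReal_nonneg)
    (fun x => by simpa using ENNReal.toReal_mono one_ne_top (fle x))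
    (fun x => by simpa using ENNReal.toReal_mono one_ne_top (gle x))
    (sup_lem f ha0 haM ft) (sup_lem g hb0 hbM gt) ?_
  · simp only [ofReal_toReal (ft _), ofReal_toReal (gt _), ofReal_toReal (ht _)] at key
    have key2 := (ENNReal.rpow_mul_rpow_le_weighted ht0 ht1 _ _).trans key
    have key3 : (∫⁻ x, f x / a) ^ (1 - t) * (∫⁻ x, g x / b) ^ t ≤ (∫⁻ x, h x) / c := by
      refine key2.trans ?_
      rw [div_eq_mul_inv, ← lintegral_mul_const' _ _ (by simpa using hc0)]
      exact lintegral_mono fun x => min_le_left _ _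
    rw [ENNReal.le_div_iff_mul_le (Or.inl hc0) (Or.inl hcM)] at key3
    refine le_trans (le_of_eq ?_) key3
    simp only [div_eq_mul_inv]
    rw [lintegral_mul_const' _ _ (by simpa using ha0), lintegral_mul_const' _ _ (by simpa using hb0),
      hc]
    rw [mul_mul_mul_comm, ← ENNReal.mul_rpow_of_nonneg _ _ h1.le,
      ← ENNReal.mul_rpow_of_nonneg _ _ ht0.le, mul_assoc, ENNReal.inv_mul_cancel ha0 haM, mul_assoc,
      ENNReal.inv_mul_cancel hb0 hbM, mul_one, mul_one]
  · intro x y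
    rw [toReal_rpow, toReal_rpow, ← toReal_mul]
    refine toReal_mono (ht _) (le_min ?_ ?_)
    · rw [ENNReal.le_div_iff_mul_le (Or.inl hc0) (Or.inl hcM), hc, mul_mul_mul_comm,
        ← ENNReal.mul_rpow_of_nonneg _ _ h1.le, ← ENNReal.mul_rpow_of_nonneg _ _ ht0.le,
        ENNReal.div_mul_cancel ha0 haM, ENNReal.div_mul_cancel hb0 hbM]
      exact H x y
    · exact mul_le_one' (ENNReal.rpow_le_one (fle x) h1.le) (ENNReal.rpow_le_one (gle y) ht0.le)

/-- The one-dimensional Prékopa–Leindler inequality. -/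
theorem prekopa_leindler_real {t : ℝ} (ht0 : 0 < t) (ht1 : t < 1) {f g h : ℝ → ℝ≥0∞}
    (hf : Measurable f) (hg : Measurable g) (hh : Measurable h)
    (H : ∀ x y, f x ^ (1 - t) * g y ^ t ≤ h ((1 - t) * x + t * y)) :
    (∫⁻ x, f x) ^ (1 - t) * (∫⁻ x, g x) ^ t ≤ ∫⁻ x, h x := by
  have h1 : 0 < 1 - t := by linarith
  have trunc : ∀ {f : ℝ → ℝ≥0∞}, Measurable f →
      ∫⁻ x, f x = ⨆ N : ℕ, ∫⁻ x, min (f x) N := by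
    intro f hf
    rw [← lintegral_iSup (fun N => hf.min measurable_const)]
    · congr with x
      rw [← inf_iSup_eq, ENNReal.iSup_natCast]
      simp
    · intro N M hNM x
      exact min_le_min_left _ (by exact_mod_cast hNM)
  have mono : ∀ (f : ℝ → ℝ≥0∞), Monotone fun N : ℕ => ∫⁻ x, min (f x) N := by
    intro f N M hNM
    exact lintegral_mono fun x => min_le_min_left _ (by exact_mod_cast hNM)
  have rp : ∀ (s : ℝ), 0 < s → ∀ u : ℕ → ℝ≥0∞, (⨆ N, u N) ^ s = ⨆ N, u N ^ s := by
    intro s hs u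
    exact (ENNReal.orderIsoRpow s hs).map_iSup u
  rw [trunc hf, trunc hg, rp _ h1, rp _ ht0, ENNReal.iSup_mul]
  refine iSup_le fun N => ?_
  rw [ENNReal.mul_iSup]
  refine iSup_le fun M => ?_
  refine (mul_le_mul' (ENNReal.rpow_le_rpow (mono f (le_max_left N M)) h1.le)
    (ENNReal.rpow_le_rpow (mono g (le_max_right N M)) ht0.le)).trans ?_
  refine prekopa_leindler_real_bounded ht0 ht1 (hf.min measurable_const)
    (hg.min measurable_const) hh (natCast_ne_top (max N M)) (fun x => min_le_right _ _)
    (fun x => min_le_right _ _) fun x y => le_trans ?_ (H x y)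
  exact mul_le_mul' (ENNReal.rpow_le_rpow (min_le_left _ _) h1.le)
    (ENNReal.rpow_le_rpow (min_le_left _ _) ht0.le)

/-- The Prékopa–Leindler inequality on `Fin n → ℝ`. -/
theorem prekopa_leindler_pi {t : ℝ} (ht0 : 0 < t) (ht1 : t < 1) (n : ℕ) :
    ∀ {f g h : (Fin n → ℝ) → ℝ≥0∞}, Measurable f → Measurable g → Measurable h →
    (∀ x y, f x ^ (1 - t) * g y ^ t ≤ h ((1 - t) • x + t • y)) →
    (∫⁻ x, f x) ^ (1 - t) * (∫⁻ x, g x) ^ t ≤ ∫⁻ x, h x := by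
  induction n with
  | zero =>
    intro f g h hf hg hh H
    rw [volume_pi, Measure.pi_of_empty _ 0, lintegral_dirac, lintegral_dirac, lintegral_dirac]
    have := H 0 0
    rwa [smul_zero, smul_zero, add_zero] at this
  | succ n ih =>
    intro f g h hf hg hh H
    have e := (volume_preserving_piFinSuccAbove (fun _ : Fin (n + 1) => ℝ) 0).symm
    have split : ∀ {f : (Fin (n + 1) → ℝ) → ℝ≥0∞}, Measurable f →
        ∫⁻ x, f x = ∫⁻ a : ℝ, ∫⁻ z : Fin n → ℝ, f (Fin.cons a z) := by
      intro f hf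
      rw [← e.lintegral_comp hf, Measure.volume_eq_prod, lintegral_prod
        (fun a => f ((MeasurableEquiv.piFinSuccAbove (fun _ => ℝ) 0).symm a))
        (hf.comp e.measurable).aemeasurable]
      simp [MeasurableEquiv.piFinSuccAbove, Fin.consEquiv]
    have cm : Measurable fun p : ℝ × (Fin n → ℝ) => (Fin.cons p.1 p.2 : Fin (n + 1) → ℝ) := by
      have := e.measurable
      simpa [MeasurableEquiv.piFinSuccAbove, Function.comp_def, Fin.consEquiv] using this
    rw [split hf, split hg, split hh]
    refine prekopa_leindler_real ht0 ht1 (Measurable.lintegral_prod_right' (hf.comp cm))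
      (Measurable.lintegral_prod_right' (hg.comp cm))
      (Measurable.lintegral_prod_right' (hh.comp cm)) fun a b => ?_
    refine ih (hf.comp (cm.comp (measurable_const.prodMk measurable_id)))
      (hg.comp (cm.comp (measurable_const.prodMk measurable_id)))
      (hh.comp (cm.comp (measurable_const.prodMk measurable_id))) fun x y => ?_
    refine (H (Fin.cons a x) (Fin.cons b y)).trans (le_of_eq ?_)
    congr 1
    ext i
    refine Fin.cases ?_ (fun j => ?_) i <;> simp

/-- The Prékopa–Leindler inequality on Euclidean space. -/
theorem prekopa_leindler {n : ℕ} {t : ℝ} (ht0 : 0 < t) (ht1 : t < 1)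
    {f g h : EuclideanSpace ℝ (Fin n) → ℝ≥0∞}
    (hf : Measurable f) (hg : Measurable g) (hh : Measurable h)
    (H : ∀ x y, f x ^ (1 - t) * g y ^ t ≤ h ((1 - t) • x + t • y)) :
    (∫⁻ x, f x) ^ (1 - t) * (∫⁻ x, g x) ^ t ≤ ∫⁻ x, h x := by
  have e := PiLp.volume_preserving_toLp (Fin n)
  rw [← e.lintegral_comp hf, ← e.lintegral_comp hg, ← e.lintegral_comp hh]
  exact prekopa_leindler_pi ht0 ht1 n (hf.comp e.measurable) (hg.comp e.measurable)
    (hh.comp e.measurable) fun x y => H _ _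

/-- One-sided first-order Taylor bound with a remainder that is uniformly small near the base
point and at most quadratic far from it. -/
def HasUniformTaylorBound {E : Type*} [NormedAddCommGroup E] [InnerProductSpace ℝ E]
    (φ : E → ℝ) (D : E → E) : Prop :=
  ∀ ε > 0, ∃ L ≥ 0, ∀ z h, φ (z + h) ≤ φ z + inner ℝ (D z) h + ε * ‖h‖ + L * ‖h‖ ^ 2

/-- Convexity with modulus `l`. -/
def IsModulusConvex {E : Type*} [NormedAddCommGroup E] [InnerProductSpace ℝ E]
    (l : ℝ) (U : E → ℝ) : Prop :=
  ∀ t, 0 < t → t < 1 → ∀ x y,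
    U ((1 - t) • x + t • y) + l / 2 * (t * (1 - t)) * ‖x - y‖ ^ 2 ≤ (1 - t) * U x + t * U y

theorem integrable_of_bounded {α : Type*} [MeasurableSpace α] {m : Measure α} [IsFiniteMeasure m]
    {f : α → ℝ} (hf : Measurable f) {B : ℝ} (hB : ∀ x, |f x| ≤ B) : Integrable f m :=
  Integrable.of_bound hf.aestronglyMeasurable B (Filter.Eventually.of_forall hB)

theorem integral_add_add {α : Type*} [MeasurableSpace α] {m : Measure α} {f g h : α → ℝ}
    (hf : Integrable f m) (hg : Integrable g m) (hh : Integrable h m) :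
    ∫ x, f x + g x + h x ∂m = (∫ x, f x ∂m) + (∫ x, g x ∂m) + ∫ x, h x ∂m := by
  rw [integral_add (f := fun x => f x + g x) (hf.add hg) hh, integral_add hf hg]

/-- Pointwise estimate behind the Prékopa–Leindler proof of the log-Sobolev inequality. -/
theorem taylor_bound_modulusConvex {E : Type*} [NormedAddCommGroup E] [InnerProductSpace ℝ E]
    {l : ℝ} (hl : 0 < l) {U φ : E → ℝ} {D : E → E} (hU : IsModulusConvex l U) {ε L : ℝ}
    (hφ : ∀ z h, φ (z + h) ≤ φ z + inner ℝ (D z) h + ε * ‖h‖ + L * ‖h‖ ^ 2)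
    {t : ℝ} (ht0 : 0 < t) (ht1 : t < 1) (htL : L * t ≤ l / 4) (x y : E) :
    (1 - t) * (φ x - U x) + t * (-U y) ≤
      (1 - t) * φ ((1 - t) • x + t • y)
        + t * (1 - t) * (2 * (‖D ((1 - t) • x + t • y)‖ ^ 2 + ε ^ 2) / l)
        - U ((1 - t) • x + t • y) := by
  have h1 := hU t ht0 ht1 x y
  set z := (1 - t) • x + t • y with hz
  have hx : x = z + t • (x - y) := by rw [hz]; module
  have h2 := hφ z (t • (x - y))
  rw [← hx, inner_smul_right, norm_smul, Real.norm_of_nonneg ht0.le] at h2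
  have h3 := real_inner_le_norm (D z) (x - y)
  set d := ‖x - y‖
  set p := ‖D z‖
  have h4 : (p + ε) * d ≤ 2 * (p ^ 2 + ε ^ 2) / l + l * d ^ 2 / 4 := by
    rw [← sub_nonneg]
    have : 2 * (p ^ 2 + ε ^ 2) / l + l * d ^ 2 / 4 - (p + ε) * d =
        ((p - ε) ^ 2 + (p + ε - l * d / 2) ^ 2) / l := by
      field_simp; ring
    rw [this]; positivity
  have h5 : φ x ≤ φ z + t * (2 * (p ^ 2 + ε ^ 2) / l) + l / 2 * t * d ^ 2 := by
    have h6 : L * t * (t * d ^ 2) ≤ l / 4 * (t * d ^ 2) :=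
      mul_le_mul_of_nonneg_right htL (by positivity)
    nlinarith [mul_le_mul_of_nonneg_left h3 ht0.le, mul_le_mul_of_nonneg_left h4 ht0.le]
  have h7 : 0 < 1 - t := by linarith
  nlinarith [mul_le_mul_of_nonneg_left h5 h7.le]

section
variable {n : ℕ}

theorem lintegral_exp_sub_eq {U ψ : EuclideanSpace ℝ (Fin n) → ℝ} (hU : Measurable U)
    (hψ : Measurable ψ) {m : Measure (EuclideanSpace ℝ (Fin n))} [IsFiniteMeasure m]
    (hm : m = volume.withDensity fun x => ENNReal.ofReal (Real.exp (-U x)))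
    {B : ℝ} (hB : ∀ x, |ψ x| ≤ B) :
    ∫⁻ x, ENNReal.ofReal (Real.exp (ψ x - U x)) = ENNReal.ofReal (∫ x, Real.exp (ψ x) ∂m) := by
  rw [ofReal_integral_eq_lintegral_ofReal
    (integrable_of_bounded (B := Real.exp B) (by fun_prop) fun x => by
      rw [abs_of_pos (Real.exp_pos _)]
      exact Real.exp_le_exp.2 (le_of_abs_le (hB x)))
    (Filter.Eventually.of_forall fun x => (Real.exp_pos _).le), hm,
    lintegral_withDensity_eq_lintegral_mul _ (by fun_prop) (by fun_prop)]
  refine lintegral_congr fun x => ?_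
  rw [Pi.mul_apply, ← ofReal_mul (Real.exp_pos _).le, ← Real.exp_add]
  congr 2; ring

/-- The log-Sobolev inequality for a finite measure `e^{-U} dx` with `U` uniformly convex. -/
theorem logSobolev_of_modulusConvex {l : ℝ} (hl : 0 < l)
    {U φ : EuclideanSpace ℝ (Fin n) → ℝ} {D : EuclideanSpace ℝ (Fin n) → EuclideanSpace ℝ (Fin n)}
    (hUm : Measurable U) (hU : IsModulusConvex l U)
    {m : Measure (EuclideanSpace ℝ (Fin n))} [IsFiniteMeasure m]
    (hm : m = volume.withDensity fun x => ENNReal.ofReal (Real.exp (-U x)))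
    (hφm : Measurable φ) (hDm : Measurable D) {B : ℝ} (hB : ∀ x, |φ x| ≤ B)
    {G : ℝ} (hG : ∀ x, ‖D x‖ ≤ G) (hφ : HasUniformTaylorBound φ D) :
    ∫ x, φ x * Real.exp (φ x) ∂m ≤
      (∫ x, Real.exp (φ x) ∂m) * Real.log ((∫ x, Real.exp (φ x) ∂m) / m.real Set.univ)
        + 2 / l * ∫ x, ‖D x‖ ^ 2 * Real.exp (φ x) ∂m := by
  have hm0 : m ≠ 0 := by
    intro h0
    rw [hm, withDensity_eq_zero_iff (by fun_prop)] at h0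
    have h1 : ∀ᵐ x : EuclideanSpace ℝ (Fin n), False := by
      filter_upwards [h0] with x hx
      simp only [Pi.zero_apply, ofReal_eq_zero] at hx
      exact (Real.exp_pos _).not_ge hx
    rw [Filter.eventually_false_iff_eq_bot, ae_eq_bot] at h1
    exact (NeZero.ne (volume : Measure (EuclideanSpace ℝ (Fin n)))) h1
  have hne : NeZero m := ⟨hm0⟩
  have hM : 0 < m.real Set.univ := measureReal_univ_pos
  set M := m.real Set.univ with hMdef
  have hexpB : ∀ x, Real.exp (φ x) ≤ Real.exp B := fun x =>
    Real.exp_le_exp.2 (le_of_abs_le (hB x))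
  have iexp : Integrable (fun x => Real.exp (φ x)) m :=
    integrable_of_bounded (B := Real.exp B) (by fun_prop) fun x => by
      rw [abs_of_pos (Real.exp_pos _)]; exact hexpB x
  have imul : ∀ {u : EuclideanSpace ℝ (Fin n) → ℝ} {C : ℝ}, Measurable u → (∀ x, |u x| ≤ C) →
      Integrable (fun x => u x * Real.exp (φ x)) m := by
    intro u C hu hC
    exact iexp.bdd_mul hu.aestronglyMeasurable (Filter.Eventually.of_forall hC)
  have iφ : Integrable (fun x => φ x * Real.exp (φ x)) m := imul hφm hB
  have hD2 : ∀ x, |‖D x‖ ^ 2| ≤ G ^ 2 := fun x => by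
    rw [abs_of_nonneg (by positivity)]
    exact pow_le_pow_left₀ (norm_nonneg _) (hG x) 2
  have iD : Integrable (fun x => ‖D x‖ ^ 2 * Real.exp (φ x)) m := imul (by fun_prop) hD2
  set A := ∫ x, Real.exp (φ x) ∂m with hA
  have hApos : 0 < A := integral_exp_pos iexp
  have main : ∀ ε > 0, A * Real.log (M / A) ≤
      (∫ x, -(φ x * Real.exp (φ x)) + 2 / l * (‖D x‖ ^ 2 * Real.exp (φ x))
        + 2 / l * ε ^ 2 * Real.exp (φ x) ∂m) := by
    intro ε hε
    obtain ⟨L, hL, hT⟩ := hφ ε hε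
    set ψ : EuclideanSpace ℝ (Fin n) → ℝ := fun x => -φ x + 2 * (‖D x‖ ^ 2 + ε ^ 2) / l with hψ
    have hψm : Measurable ψ := by fun_prop
    have hψ0 : ∃ c > 0, ∀ x, |ψ x| ≤ c := by
      refine ⟨B + 2 * (G ^ 2 + ε ^ 2) / l + 1, ?_, fun x => ?_⟩
      · have : 0 ≤ B := (abs_nonneg _).trans (hB 0)
        positivity
      · refine (abs_add_le _ _).trans ?_
        rw [abs_neg, abs_of_nonneg (by positivity : 0 ≤ 2 * (‖D x‖ ^ 2 + ε ^ 2) / l)]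
        have h1 := hB x
        have h2 : 2 * (‖D x‖ ^ 2 + ε ^ 2) / l ≤ 2 * (G ^ 2 + ε ^ 2) / l := by
          have := (le_abs_self _).trans (hD2 x)
          gcongr
        linarith
    obtain ⟨c, hc, hψc⟩ := hψ0
    have iψ : Integrable (fun x => ψ x * Real.exp (φ x)) m := imul hψm hψc
    have step : ∀ t, 0 < t → t < 1 → L * t ≤ l / 4 → t * c ≤ 1 →
        A * Real.log (M / A) ≤ (∫ x, ψ x * Real.exp (φ x) ∂m) + t * (c ^ 2 * A) := by
      intro t ht0 ht1 htL htc
      have h1t : 0 < 1 - t := by linarith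
      have habs : ∀ x, |t * ψ x| ≤ 1 := fun x => by
        rw [abs_mul, abs_of_pos ht0]
        exact (mul_le_mul_of_nonneg_left (hψc x) ht0.le).trans htc
      have pl := prekopa_leindler ht0 ht1 (f := fun x => ENNReal.ofReal (Real.exp (φ x - U x)))
        (g := fun x => ENNReal.ofReal (Real.exp (0 - U x)))
        (h := fun x => ENNReal.ofReal (Real.exp ((φ x + t * ψ x) - U x)))
        (by fun_prop) (by fun_prop) (by fun_prop) (by
          intro x y
          rw [ofReal_rpow_of_pos (Real.exp_pos _), ofReal_rpow_of_pos (Real.exp_pos _),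
            ← ofReal_mul (by positivity), ← Real.exp_mul, ← Real.exp_mul, ← Real.exp_add]
          refine ofReal_le_ofReal (Real.exp_le_exp.2 ?_)
          have h1 := taylor_bound_modulusConvex hl hU hT ht0 ht1 htL x y
          set z := (1 - t) • x + t • y
          have h2 : 0 ≤ t * t * (2 * (‖D z‖ ^ 2 + ε ^ 2) / l) := by positivity
          simp only [hψ]
          nlinarith)
      rw [lintegral_exp_sub_eq hUm hφm hm hB, lintegral_exp_sub_eq hUm measurable_const hm
        (B := 0) (by simp), lintegral_exp_sub_eq hUm (by fun_prop) hm (B := B + 1)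
        (fun x => (abs_add_le _ _).trans (add_le_add (hB x) (habs x)))] at pl
      simp only [Real.exp_zero, integral_const, smul_eq_mul, mul_one] at pl
      rw [ofReal_rpow_of_pos hApos, ofReal_rpow_of_pos hM, ← ofReal_mul (by positivity),
        ofReal_le_ofReal_iff (integral_nonneg fun x => (Real.exp_pos _).le)] at pl
      have h1 : A * (1 + t * Real.log (M / A)) ≤ A ^ (1 - t) * M ^ t := by
        have : A ^ (1 - t) * M ^ t = A * Real.exp (t * Real.log (M / A)) := by
          rw [Real.rpow_def_of_pos hApos, Real.rpow_def_of_pos hM,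
            Real.log_div hM.ne' hApos.ne', ← Real.exp_add]
          have e : ∀ s, A * Real.exp s = Real.exp (Real.log A + s) := fun s => by
            rw [Real.exp_add, Real.exp_log hApos]
          rw [e]; congr 1; ring
        rw [this]
        refine mul_le_mul_of_nonneg_left ?_ hApos.le
        linarith [Real.add_one_le_exp (t * Real.log (M / A))]
      have h2 : ∫ x, Real.exp (φ x + t * ψ x) ∂m ≤
          ∫ x, Real.exp (φ x) + t * (ψ x * Real.exp (φ x)) + t ^ 2 * c ^ 2 * Real.exp (φ x) ∂m := by
        refine integral_mono_of_nonneg (Filter.Eventually.of_forall fun x => (Real.exp_pos _).le)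
          ((iexp.add (iψ.const_mul t)).add (iexp.const_mul _))
          (Filter.Eventually.of_forall fun x => ?_)
        have h3 := Real.abs_exp_sub_one_sub_id_le (habs x)
        have h4 : (t * ψ x) ^ 2 ≤ t ^ 2 * c ^ 2 := by
          rw [mul_pow]
          exact mul_le_mul_of_nonneg_left (sq_le_sq' (by linarith [neg_le_of_abs_le (hψc x)])
            (le_of_abs_le (hψc x))) (by positivity)
        have h5 : Real.exp (t * ψ x) ≤ 1 + t * ψ x + t ^ 2 * c ^ 2 := by
          linarith [le_of_abs_le h3]
        simp only [Real.exp_add]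
        nlinarith [mul_le_mul_of_nonneg_left h5 (Real.exp_pos (φ x)).le]
      rw [integral_add_add iexp (iψ.const_mul t) (iexp.const_mul _), integral_const_mul,
        integral_const_mul] at h2
      have h3 := (h1.trans pl).trans h2
      have h4 : t * (A * Real.log (M / A)) ≤
          t * ((∫ x, ψ x * Real.exp (φ x) ∂m) + t * (c ^ 2 * A)) := by
        simp only [← hA] at h3
        nlinarith
      exact le_of_mul_le_mul_left h4 ht0
    have lim : A * Real.log (M / A) ≤ ∫ x, ψ x * Real.exp (φ x) ∂m := by
      refine le_of_forall_pos_le_add fun η hη => ?_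
      have hcA : 0 < c ^ 2 * A := by positivity
      set t := min (1 / 2) (min (l / 4 / (L + 1)) (min (1 / c) (η / (c ^ 2 * A)))) with ht
      have ht0 : 0 < t := by
        refine lt_min (by norm_num) (lt_min (by positivity) (lt_min (by positivity) (by positivity)))
      have h1 : t ≤ 1 / 2 := min_le_left _ _
      have h2 : t ≤ l / 4 / (L + 1) := (min_le_right _ _).trans (min_le_left _ _)
      have h3 : t ≤ 1 / c := (min_le_right _ _).trans ((min_le_right _ _).trans (min_le_left _ _))
      have h4 : t ≤ η / (c ^ 2 * A) :=
        (min_le_right _ _).trans ((min_le_right _ _).trans (min_le_right _ _))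
      rw [le_div_iff₀ (by positivity)] at h2 h3 h4
      have := step t ht0 (by linarith) (by nlinarith) h3
      linarith
    refine lim.trans (le_of_eq (integral_congr_ae (Filter.Eventually.of_forall fun x => ?_)))
    simp only [hψ]
    field_simp
    ring
  have fin : ∀ ε > 0, A * Real.log (M / A) ≤ -(∫ x, φ x * Real.exp (φ x) ∂m)
      + 2 / l * (∫ x, ‖D x‖ ^ 2 * Real.exp (φ x) ∂m) + 2 / l * ε ^ 2 * A := by
    intro ε hε
    have := main ε hε
    rwa [integral_add_add (f := fun x => -(φ x * Real.exp (φ x))) iφ.neg (iD.const_mul _) (iexp.const_mul _), integral_const_mul,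
      integral_const_mul, integral_neg] at this
  have flip : Real.log (A / M) = -Real.log (M / A) := by
    rw [← Real.log_inv, inv_div]
  rw [flip]
  suffices A * Real.log (M / A) ≤ -(∫ x, φ x * Real.exp (φ x) ∂m)
      + 2 / l * (∫ x, ‖D x‖ ^ 2 * Real.exp (φ x) ∂m) by linarith
  refine le_of_forall_pos_le_add fun η hη => ?_
  have hpos : 0 < 2 / l * A := by positivity
  have := fin (Real.sqrt (η / (2 / l * A))) (by positivity)
  rw [Real.sq_sqrt (by positivity)] at this
  have e : 2 / l * (η / (2 / l * A)) * A = η := by field_simp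
  linarith

end

/-- A lower bound on the Hessian gives convexity with a modulus. -/
theorem isModulusConvex_of_hessian {n : ℕ} {V : EuclideanSpace ℝ (Fin n) → ℝ}
    (hV : ContDiff ℝ 2 V) {K : ℝ} (hK : ∀ x v : EuclideanSpace ℝ (Fin n),
      K * ‖v‖ ^ 2 ≤ iteratedFDeriv ℝ 2 V x ![v, v]) : IsModulusConvex K V := by
  intro t ht0 ht1 x y
  set v := y - x with hv
  set d := ‖v‖ with hd
  have hV1 : ContDiff ℝ 1 (fderiv ℝ V) := hV.fderiv_right (by norm_num)
  have hγ : ∀ s : ℝ, HasDerivAt (fun s : ℝ => x + s • v) v s := fun s => by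
    simpa using ((hasDerivAt_id s).smul_const v).const_add x
  have h1 : ∀ s : ℝ, HasDerivAt (fun s : ℝ => V (x + s • v)) (fderiv ℝ V (x + s • v) v) s :=
    fun s => ((hV.differentiable (by norm_num)) _).hasFDerivAt.comp_hasDerivAt s (hγ s)
  have h2 : ∀ s : ℝ, HasDerivAt (fun s : ℝ => fderiv ℝ V (x + s • v) v)
      (fderiv ℝ (fderiv ℝ V) (x + s • v) v v) s := fun s => by
    have := (((hV1.differentiable (by norm_num)) _).hasFDerivAt.comp_hasDerivAt s (hγ s)).clm_apply
      (hasDerivAt_const s v)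
    simpa using this
  have h3 : ∀ s : ℝ, K * d ^ 2 ≤ fderiv ℝ (fderiv ℝ V) (x + s • v) v v := fun s => by
    simpa [iteratedFDeriv_two_apply] using hK (x + s • v) v
  have q1 : ∀ s : ℝ, HasDerivAt (fun s : ℝ => V (x + s • v) - K * d ^ 2 / 2 * s ^ 2)
      (fderiv ℝ V (x + s • v) v - K * d ^ 2 * s) s := fun s =>
    ((h1 s).sub (((hasDerivAt_id' s).pow 2).const_mul (K * d ^ 2 / 2))).congr_deriv
      (by push_cast; ring)
  have q2 : ∀ s : ℝ, HasDerivAt (fun s : ℝ => fderiv ℝ V (x + s • v) v - K * d ^ 2 * s)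
      (fderiv ℝ (fderiv ℝ V) (x + s • v) v v - K * d ^ 2) s := fun s =>
    ((h2 s).sub ((hasDerivAt_id' s).const_mul (K * d ^ 2))).congr_deriv (by ring)
  have conv : ConvexOn ℝ Set.univ (fun s : ℝ => V (x + s • v) - K * d ^ 2 / 2 * s ^ 2) :=
    convexOn_of_hasDerivWithinAt2_nonneg convex_univ
      (fun s _ => (q1 s).continuousAt.continuousWithinAt)
      (fun s _ => (q1 s).hasDerivWithinAt) (fun s _ => (q2 s).hasDerivWithinAt)
      (fun s _ => sub_nonneg.2 (h3 s))
  have := conv.2 (Set.mem_univ 0) (Set.mem_univ 1) (sub_nonneg.2 ht1.le) ht0.le (by ring)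
  simp only [smul_eq_mul, mul_zero, mul_one, zero_add, zero_smul, add_zero, one_smul] at this
  have e1 : x + v = y := by rw [hv]; abel
  have e2 : x + t • v = (1 - t) • x + t • y := by rw [hv]; module
  rw [e1, e2] at this
  have e3 : ‖x - y‖ = d := by rw [hd, hv, norm_sub_rev]
  rw [e3]
  nlinarith

/-- Adding a Gaussian weight improves the convexity modulus. -/
theorem IsModulusConvex.add_sq {E : Type*} [NormedAddCommGroup E] [InnerProductSpace ℝ E]
    {K : ℝ} {V : E → ℝ} (hV : IsModulusConvex K V) (a c : ℝ) (w : E) :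
    IsModulusConvex (K + 2 * a) fun x => V x + c + a * ‖x - w‖ ^ 2 := by
  intro t ht0 ht1 x y
  have h := hV t ht0 ht1 x y
  have e : ‖(1 - t) • x + t • y - w‖ ^ 2 + t * (1 - t) * ‖x - y‖ ^ 2 =
      (1 - t) * ‖x - w‖ ^ 2 + t * ‖y - w‖ ^ 2 := by
    have e1 : (1 - t) • x + t • y - w = (1 - t) • (x - w) + t • (y - w) := by module
    have e2 : x - y = (x - w) - (y - w) := by abel
    rw [e1, e2, norm_add_sq_real, norm_sub_sq_real, norm_smul, norm_smul, inner_smul_left,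
      inner_smul_right, mul_pow, mul_pow]
    simp only [Real.norm_eq_abs, sq_abs, conj_trivial]
    ring
  simp only
  have : a * (‖(1 - t) • x + t • y - w‖ ^ 2 + t * (1 - t) * ‖x - y‖ ^ 2) =
      a * ((1 - t) * ‖x - w‖ ^ 2 + t * ‖y - w‖ ^ 2) := by rw [e]
  linarith

theorem IsModulusConvex.mono {E : Type*} [NormedAddCommGroup E] [InnerProductSpace ℝ E]
    {K l : ℝ} {V : E → ℝ} (hV : IsModulusConvex K V) (h : l ≤ K) : IsModulusConvex l V := by
  intro t ht0 ht1 x y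
  refine le_trans ?_ (hV t ht0 ht1 x y)
  have : 0 < 1 - t := by linarith
  gcongr

section gaussian
variable {E : Type*} [NormedAddCommGroup E]

/-- The unnormalized Gaussian kernel of variance `T`. -/
noncomputable def gaussKernel (T : ℝ) (w : E) : ℝ := Real.exp (-(1 / (2 * T)) * ‖w‖ ^ 2)

theorem gaussKernel_pos (T : ℝ) (w : E) : 0 < gaussKernel T w := Real.exp_pos _

theorem gaussKernel_le_one {T : ℝ} (hT : 0 < T) (w : E) : gaussKernel T w ≤ 1 := by
  refine Real.exp_le_one_iff.2 ?_
  have : 0 ≤ 1 / (2 * T) * ‖w‖ ^ 2 := by positivity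
  linarith

theorem continuous_gaussKernel (T : ℝ) : Continuous (gaussKernel T : E → ℝ) := by
  unfold gaussKernel; fun_prop

theorem sq_mul_gaussKernel_le {T : ℝ} (hT : 0 < T) (w : E) :
    ‖w‖ ^ 2 * gaussKernel T w ≤ 2 * T := by
  have h := Real.add_one_le_exp (1 / (2 * T) * ‖w‖ ^ 2)
  have e : gaussKernel T w = (Real.exp (1 / (2 * T) * ‖w‖ ^ 2))⁻¹ := by
    rw [← Real.exp_neg, gaussKernel]; congr 1; ring
  rw [e, ← div_eq_mul_inv, div_le_iff₀ (Real.exp_pos _)]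
  have h2 : 2 * T * (1 / (2 * T) * ‖w‖ ^ 2) = ‖w‖ ^ 2 := by field_simp
  nlinarith

variable [InnerProductSpace ℝ E] [FiniteDimensional ℝ E] [MeasurableSpace E] [BorelSpace E]

theorem integrable_gaussKernel {T : ℝ} (hT : 0 < T) : Integrable (gaussKernel T : E → ℝ) := by
  have := GaussianFourier.integrable_cexp_neg_mul_sq_norm_add (V := E) (b := ((1 / (2 * T) : ℝ) : ℂ))
    (by simpa using hT) 0 0
  refine this.re.congr (Filter.Eventually.of_forall fun w => ?_)
  simp only [gaussKernel, inner_zero_left, Complex.ofReal_zero, mul_zero, add_zero]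
  rw [← Complex.ofReal_pow, ← Complex.ofReal_neg, ← Complex.ofReal_mul,
    ← Complex.ofReal_exp]
  rfl

theorem integrable_norm_mul_gaussKernel {T : ℝ} (hT : 0 < T) :
    Integrable (fun w : E => ‖w‖ * gaussKernel T w) := by
  refine Integrable.mono' ((integrable_gaussKernel (E := E) (T := 2 * T) (by positivity)).const_mul
    (4 * T + 1)) (continuous_norm.mul (continuous_gaussKernel T)).aestronglyMeasurable
    (Filter.Eventually.of_forall fun w => ?_)
  have e : gaussKernel T w = gaussKernel (2 * T) w * gaussKernel (2 * T) w := by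
    rw [gaussKernel, gaussKernel, ← Real.exp_add]; congr 1; field_simp; ring
  have h1 := sq_mul_gaussKernel_le (T := 2 * T) (by positivity) w
  have h2 := gaussKernel_le_one (T := 2 * T) (by positivity) w
  have h3 := gaussKernel_pos (2 * T) w
  rw [Real.norm_of_nonneg (mul_nonneg (norm_nonneg _) (gaussKernel_pos T w).le), e, ← mul_assoc]
  refine mul_le_mul_of_nonneg_right ?_ h3.le
  nlinarith [mul_nonneg (sq_nonneg (‖w‖ - 1)) h3.le, mul_nonneg (norm_nonneg w) h3.le]

theorem integral_gaussKernel_pos {T : ℝ} (hT : 0 < T) : 0 < ∫ w : E, gaussKernel T w :=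
  integral_exp_pos (integrable_gaussKernel hT)

theorem integral_gaussKernel_mul_inner (T : ℝ) (v : E) :
    ∫ w : E, gaussKernel T w * inner ℝ v w = 0 := by
  have h := integral_neg_eq_self (fun w : E => gaussKernel T w * inner ℝ v w) volume
  have : ∀ w : E, gaussKernel T (-w) * inner ℝ v (-w) = -(gaussKernel T w * inner ℝ v w) := by
    intro w; simp [gaussKernel]
  simp only [this, integral_neg] at h
  linarith

end gaussian

theorem integral_withDensity_ofReal {α : Type*} [MeasurableSpace α] {m : Measure α} {g : α → ℝ}
    (hg : Measurable g) (hg0 : ∀ x, 0 ≤ g x) (f : α → ℝ) :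
    ∫ x, f x ∂(m.withDensity fun x => ENNReal.ofReal (g x)) = ∫ x, f x * g x ∂m := by
  rw [integral_withDensity_eq_integral_toReal_smul hg.ennreal_ofReal
    (Filter.Eventually.of_forall fun _ => ENNReal.ofReal_lt_top)]
  refine integral_congr_ae (Filter.Eventually.of_forall fun x => ?_)
  simp [ENNReal.toReal_ofReal (hg0 x), mul_comm]

theorem integral_sub_sub {α : Type*} [MeasurableSpace α] {m : Measure α} {f g h : α → ℝ}
    (hf : Integrable f m) (hg : Integrable g m) (hh : Integrable h m) :
    ∫ x, f x - g x - h x ∂m = (∫ x, f x ∂m) - (∫ x, g x ∂m) - ∫ x, h x ∂m := by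
  rw [integral_sub (f := fun x => f x - g x) (hf.sub hg) hh, integral_sub hf hg]

theorem integral_pos_of_pos {α : Type*} [MeasurableSpace α] {m : Measure α} [NeZero m]
    {f : α → ℝ} (hf0 : ∀ x, 0 < f x) (hf : Integrable f m) : 0 < ∫ x, f x ∂m := by
  rw [integral_pos_iff_support_of_nonneg (fun x => (hf0 x).le) hf,
    show Function.support f = Set.univ from Set.eq_univ_of_forall fun x => (hf0 x).ne']
  exact Measure.measure_univ_pos.2 (NeZero.ne m)

/-- Integral form of the log-sum inequality. -/
theorem log_sum_le_integral {α : Type*} [MeasurableSpace α] {π : Measure α} {f g : α → ℝ}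
    (hf0 : ∀ x, 0 < f x) (hg0 : ∀ x, 0 < g x) (hf : Integrable f π) (hg : Integrable g π)
    (hfg : Integrable (fun x => f x * (Real.log (f x) - Real.log (g x))) π)
    (hF : 0 < ∫ x, f x ∂π) (hG : 0 < ∫ x, g x ∂π) :
    (∫ x, f x ∂π) * Real.log ((∫ x, f x ∂π) / ∫ x, g x ∂π) ≤
      ∫ x, f x * (Real.log (f x) - Real.log (g x)) ∂π := by
  set F := ∫ x, f x ∂π
  set G := ∫ x, g x ∂π
  set c := F / G
  have hc : 0 < c := by positivity
  have key : ∀ x, f x * Real.log c + (f x - c * g x) ≤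
      f x * (Real.log (f x) - Real.log (g x)) := by
    intro x
    have h1 := Real.log_le_sub_one_of_pos (x := c * g x / f x) (by have := hf0 x; have := hg0 x; positivity)
    rw [Real.log_div (mul_pos hc (hg0 x)).ne' (hf0 x).ne', Real.log_mul hc.ne' (hg0 x).ne'] at h1
    have h2 := mul_le_mul_of_nonneg_left h1 (hf0 x).le
    have h3 : f x * (c * g x / f x - 1) = c * g x - f x := by
      have := (hf0 x).ne'
      field_simp
    rw [h3] at h2
    nlinarith
  have := integral_mono ((hf.mul_const (Real.log c)).add (hf.sub (hg.const_mul c))) hfg key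
  simp only [Pi.add_apply, Pi.sub_apply] at this
  have e : ∫ x, f x * Real.log c + (f x - c * g x) ∂π = F * Real.log c + (F - c * G) := by
    rw [integral_add (g := fun x => f x - c * g x) (hf.mul_const _) (hf.sub (hg.const_mul c)), integral_mul_const,
      integral_sub hf (hg.const_mul c), integral_const_mul]
  rw [e] at this
  have e2 : c * G = F := div_mul_cancel₀ _ hG.ne'
  linarith

section
variable {E : Type*} [NormedAddCommGroup E] [InnerProductSpace ℝ E] [FiniteDimensional ℝ E]
  [MeasurableSpace E] [BorelSpace E]

theorem integrable_mul_comp_sub {Q : Type*} [MeasurableSpace Q] {π : Measure Q} [SFinite π]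
    {p : Q → E} (hp : Measurable p) {b : Q → ℝ} (hb : Integrable b π) {k : E → ℝ}
    (hk : Integrable k) :
    Integrable (fun z : Q × E => b z.1 * k (p z.1 - z.2)) (π.prod volume) := by
  have h1 := hb.mul_prod hk
  have h2 : MeasurePreserving (fun z : Q × E => (z.1, p z.1 - z.2)) (π.prod volume)
      (π.prod volume) :=
    MeasurePreserving.skew_product (g := fun q y => p q - y) (MeasurePreserving.id π)
      (by fun_prop)
      (Filter.Eventually.of_forall fun q => (Measure.measurePreserving_sub_left volume (p q)).map_eq)
  exact h2.integrable_comp_of_integrable h1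

/-- If the Gaussian averages of `A(q) - ⟪w(q), p(q) - y⟫` are nonpositive for all centres `y`,
then so is the integral of `A`. -/
theorem integral_nonpos_of_gaussian_average {Q : Type*} [MeasurableSpace Q] {π : Measure Q}
    [SFinite π] {T : ℝ} (hT : 0 < T) {p w : Q → E} (hp : Measurable p) (hw : Measurable w)
    {A : Q → ℝ} (hA : Integrable A π) (hwi : Integrable w π)
    (h : ∀ y, ∫ q, gaussKernel T (p q - y) * (A q - inner ℝ (w q) (p q - y)) ∂π ≤ 0) :
    ∫ q, A q ∂π ≤ 0 := by
  have i1 := integrable_mul_comp_sub hp hA (integrable_gaussKernel hT)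
  have i2 : Integrable (fun z : Q × E => gaussKernel T (p z.1 - z.2) *
      inner ℝ (w z.1) (p z.1 - z.2)) (π.prod volume) := by
    refine Integrable.mono' (integrable_mul_comp_sub hp hwi.norm
      (integrable_norm_mul_gaussKernel hT)) ?_ (Filter.Eventually.of_forall fun z => ?_)
    · have hm : Measurable (gaussKernel T : E → ℝ) := (continuous_gaussKernel T).measurable
      exact ((hm.comp (by fun_prop)).mul
        (Measurable.inner (by fun_prop) (by fun_prop))).aestronglyMeasurable
    · have h1 := norm_inner_le_norm (𝕜 := ℝ) (w z.1) (p z.1 - z.2)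
      rw [norm_mul, Real.norm_of_nonneg (gaussKernel_pos T _).le]
      nlinarith [gaussKernel_pos T (p z.1 - z.2)]
  have i3 : Integrable (fun z : Q × E => gaussKernel T (p z.1 - z.2) *
      (A z.1 - inner ℝ (w z.1) (p z.1 - z.2))) (π.prod volume) := by
    refine (i1.sub i2).congr (Filter.Eventually.of_forall fun z => ?_)
    simp only [Pi.sub_apply]; ring
  have sw := integral_integral_swap (f := fun (q : Q) (y : E) => gaussKernel T (p q - y) *
      (A q - inner ℝ (w q) (p q - y))) i3
  have le : ∫ y : E, ∫ q, gaussKernel T (p q - y) * (A q - inner ℝ (w q) (p q - y)) ∂π ≤ 0 :=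
    integral_nonpos h
  rw [← sw] at le
  have inn : ∀ q, ∫ y : E, gaussKernel T (p q - y) * (A q - inner ℝ (w q) (p q - y)) =
      (∫ v : E, gaussKernel T v) * A q := by
    intro q
    rw [integral_sub_left_eq_self (fun v : E => gaussKernel T v * (A q - inner ℝ (w q) v)) volume
      (p q)]
    have j1 : Integrable fun v : E => gaussKernel T v * A q := (integrable_gaussKernel hT).mul_const _
    have j2 : Integrable fun v : E => gaussKernel T v * inner ℝ (w q) v := by
      refine Integrable.mono' ((integrable_norm_mul_gaussKernel hT).const_mul ‖w q‖)
        ((continuous_gaussKernel T).mul (by fun_prop)).aestronglyMeasurable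
        (Filter.Eventually.of_forall fun v => ?_)
      have h1 := norm_inner_le_norm (𝕜 := ℝ) (w q) v
      rw [norm_mul, Real.norm_of_nonneg (gaussKernel_pos T _).le]
      nlinarith [gaussKernel_pos T v]
    simp only [mul_sub]
    rw [integral_sub j1 j2, integral_gaussKernel_mul_inner, integral_mul_const, sub_zero]
  simp only [inn] at le
  rw [integral_const_mul] at le
  exact nonpos_of_mul_nonpos_right le (integral_gaussKernel_pos hT)

end

section
variable {n : ℕ}

/-- The log-Sobolev inequality localized by a Gaussian, combined with the log-sum inequality
along a coupling. -/
theorem gaussian_average_nonpos {W φ : EuclideanSpace ℝ (Fin n) → ℝ} (hWm : Measurable W)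
    {K T : ℝ} (hW : IsModulusConvex K W) (hT : 0 < T) (hKT : 1 / (2 * T) ≤ K + 1 / T)
    {μ : Measure (EuclideanSpace ℝ (Fin n))} [IsProbabilityMeasure μ]
    (hμ : μ = volume.withDensity fun x => ENNReal.ofReal (Real.exp (-W x)))
    {D : EuclideanSpace ℝ (Fin n) → EuclideanSpace ℝ (Fin n)} (hφm : Measurable φ)
    (hDm : Measurable D) {B G : ℝ} (hB : ∀ x, |φ x| ≤ B) (hG : ∀ x, ‖D x‖ ≤ G)
    (hφ : HasUniformTaylorBound φ D)
    {π : Measure (EuclideanSpace ℝ (Fin n) × EuclideanSpace ℝ (Fin n))} [IsProbabilityMeasure π]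
    (hπ1 : π.map Prod.fst = μ.withDensity fun x => ENNReal.ofReal (Real.exp (φ x)))
    (hπ2 : π.map Prod.snd = μ) (hπ : Integrable (fun q => ‖q.2 - q.1‖ ^ 2) π)
    (y : EuclideanSpace ℝ (Fin n)) :
    ∫ q, gaussKernel T (q.1 - y) *
      ((φ q.1 - 4 * T * ‖D q.1‖ ^ 2 - 1 / (2 * T) * ‖q.2 - q.1‖ ^ 2)
        - inner ℝ ((1 / T) • (q.2 - q.1)) (q.1 - y)) ∂π ≤ 0 := by
  have hγm : Measurable fun x : EuclideanSpace ℝ (Fin n) => gaussKernel T (x - y) :=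
    ((continuous_gaussKernel T).comp (continuous_id.sub continuous_const)).measurable
  have hγ0 : ∀ x : EuclideanSpace ℝ (Fin n), 0 < gaussKernel T (x - y) :=
    fun x => gaussKernel_pos T _
  have hγ1 : ∀ x : EuclideanSpace ℝ (Fin n), gaussKernel T (x - y) ≤ 1 :=
    fun x => gaussKernel_le_one hT _
  set U : EuclideanSpace ℝ (Fin n) → ℝ := fun x => W x + 0 + 1 / (2 * T) * ‖x - y‖ ^ 2 with hUdef
  have hU : IsModulusConvex (1 / (2 * T)) U :=
    (hW.add_sq (1 / (2 * T)) 0 y).mono (by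
      have : 2 * (1 / (2 * T)) = 1 / T := by field_simp
      rw [this]; exact hKT)
  have hUm : Measurable U := by fun_prop
  set m := μ.withDensity fun x => ENNReal.ofReal (gaussKernel T (x - y)) with hmdef
  have hm : m = volume.withDensity fun x => ENNReal.ofReal (Real.exp (-U x)) := by
    rw [hmdef, hμ, ← withDensity_mul _ (by fun_prop) hγm.ennreal_ofReal]
    congr 1
    ext x
    rw [Pi.mul_apply, ← ENNReal.ofReal_mul (Real.exp_pos _).le, gaussKernel, ← Real.exp_add]
    congr 2
    simp only [hUdef]; ring
  have hmfin : IsFiniteMeasure m := by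
    refine isFiniteMeasure_withDensity_ofReal (integrable_of_bounded (B := 1) hγm fun x => ?_).2
    rw [abs_of_pos (hγ0 x)]; exact hγ1 x
  have lsi := logSobolev_of_modulusConvex (by positivity) hUm hU hm hφm hDm hB hG hφ
  have hem : Measurable fun x => Real.exp (φ x) := hφm.exp
  have tr1 : ∀ f : EuclideanSpace ℝ (Fin n) → ℝ, Measurable f →
      ∫ q, f q.1 ∂π = ∫ x, f x * Real.exp (φ x) ∂μ := by
    intro f hf
    rw [← integral_withDensity_ofReal hem (fun x => (Real.exp_pos _).le), ← hπ1,
      integral_map measurable_fst.aemeasurable hf.aestronglyMeasurable]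
  have tr2 : ∀ f : EuclideanSpace ℝ (Fin n) → ℝ, Measurable f →
      ∫ q, f q.2 ∂π = ∫ x, f x ∂μ := by
    intro f hf
    rw [← hπ2, integral_map measurable_snd.aemeasurable hf.aestronglyMeasurable]
  have eF : ∫ x, Real.exp (φ x) ∂m = ∫ q, gaussKernel T (q.1 - y) ∂π := by
    rw [hmdef, integral_withDensity_ofReal hγm (fun x => (hγ0 x).le),
      tr1 (fun x => gaussKernel T (x - y)) hγm]
    simp only [mul_comm]
  have em : m.real Set.univ = ∫ q, gaussKernel T (q.2 - y) ∂π := by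
    rw [tr2 (fun x => gaussKernel T (x - y)) hγm]
    have := integral_withDensity_ofReal (m := μ) hγm (fun x => (hγ0 x).le) fun _ => 1
    simp only [integral_const, smul_eq_mul, mul_one, one_mul] at this
    exact this
  have eH : ∫ x, φ x * Real.exp (φ x) ∂m = ∫ q, φ q.1 * gaussKernel T (q.1 - y) ∂π := by
    rw [hmdef, integral_withDensity_ofReal hγm (fun x => (hγ0 x).le),
      tr1 (fun x => φ x * gaussKernel T (x - y)) (hφm.mul hγm)]
    exact integral_congr_ae (Filter.Eventually.of_forall fun x => by simp only; ring)
  have eD : ∫ x, ‖D x‖ ^ 2 * Real.exp (φ x) ∂m =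
      ∫ q, ‖D q.1‖ ^ 2 * gaussKernel T (q.1 - y) ∂π := by
    rw [hmdef, integral_withDensity_ofReal hγm (fun x => (hγ0 x).le),
      tr1 (fun x => ‖D x‖ ^ 2 * gaussKernel T (x - y)) ((hDm.norm.pow_const 2).mul hγm)]
    exact integral_congr_ae (Filter.Eventually.of_forall fun x => by simp only; ring)
  rw [eH, eF, em, eD] at lsi
  have hγm1 : Measurable fun q : EuclideanSpace ℝ (Fin n) × EuclideanSpace ℝ (Fin n) =>
      gaussKernel T (q.1 - y) := hγm.comp measurable_fst
  have hγm2 : Measurable fun q : EuclideanSpace ℝ (Fin n) × EuclideanSpace ℝ (Fin n) =>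
      gaussKernel T (q.2 - y) := hγm.comp measurable_snd
  have ig1 : Integrable (fun q : EuclideanSpace ℝ (Fin n) × EuclideanSpace ℝ (Fin n) =>
      gaussKernel T (q.1 - y)) π := integrable_of_bounded (B := 1) hγm1 fun q => by
    rw [abs_of_pos (hγ0 _)]; exact hγ1 _
  have ig2 : Integrable (fun q : EuclideanSpace ℝ (Fin n) × EuclideanSpace ℝ (Fin n) =>
      gaussKernel T (q.2 - y)) π := integrable_of_bounded (B := 1) hγm2 fun q => by
    rw [abs_of_pos (hγ0 _)]; exact hγ1 _
  have elog : ∀ q : EuclideanSpace ℝ (Fin n) × EuclideanSpace ℝ (Fin n),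
      Real.log (gaussKernel T (q.1 - y)) - Real.log (gaussKernel T (q.2 - y)) =
        1 / (2 * T) * ‖q.2 - q.1‖ ^ 2 + inner ℝ ((1 / T) • (q.2 - q.1)) (q.1 - y) := by
    intro q
    have e : q.2 - y = (q.2 - q.1) + (q.1 - y) := by abel
    rw [gaussKernel, gaussKernel, Real.log_exp, Real.log_exp, e, norm_add_sq_real,
      inner_smul_left]
    simp only [conj_trivial]
    field_simp; ring
  have ilog : Integrable (fun q : EuclideanSpace ℝ (Fin n) × EuclideanSpace ℝ (Fin n) =>
      gaussKernel T (q.1 - y) * (Real.log (gaussKernel T (q.1 - y)) -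
        Real.log (gaussKernel T (q.2 - y)))) π := by
    refine Integrable.mono' ((hπ.const_mul (1 / T)).add (integrable_const (1 : ℝ)))
      (hγm1.mul (hγm1.log.sub hγm2.log)).aestronglyMeasurable
      (Filter.Eventually.of_forall fun q => ?_)
    rw [elog q, norm_mul, Real.norm_of_nonneg (hγ0 _).le, Pi.add_apply]
    have h1 := norm_inner_le_norm (𝕜 := ℝ) ((1 / T) • (q.2 - q.1)) (q.1 - y)
    rw [norm_smul, Real.norm_of_nonneg (by positivity : (0 : ℝ) ≤ 1 / T)] at h1
    have h2 := sq_mul_gaussKernel_le hT (q.1 - y)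
    have h3 := hγ1 q.1
    have h4 := hγ0 q.1
    have h5 := norm_add_le (1 / (2 * T) * ‖q.2 - q.1‖ ^ 2)
      (inner ℝ ((1 / T) • (q.2 - q.1)) (q.1 - y))
    rw [Real.norm_of_nonneg (by positivity : (0 : ℝ) ≤ 1 / (2 * T) * ‖q.2 - q.1‖ ^ 2)] at h5
    set a := ‖q.2 - q.1‖
    set b := ‖q.1 - y‖
    set γ := gaussKernel T (q.1 - y)
    have h6 : 1 / T * a * b ≤ 1 / (2 * T) * a ^ 2 + 1 / (2 * T) * b ^ 2 := by
      rw [← sub_nonneg]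
      have : 1 / (2 * T) * a ^ 2 + 1 / (2 * T) * b ^ 2 - 1 / T * a * b =
          (a - b) ^ 2 / (2 * T) := by field_simp; ring
      rw [this]; positivity
    have h7 : 1 / (2 * T) * a ^ 2 + 1 / (2 * T) * a ^ 2 = 1 / T * a ^ 2 := by field_simp; ring
    calc γ * ‖1 / (2 * T) * a ^ 2 + inner ℝ ((1 / T) • (q.2 - q.1)) (q.1 - y)‖
        ≤ γ * (1 / T * a ^ 2 + 1 / (2 * T) * b ^ 2) :=
          mul_le_mul_of_nonneg_left (by linarith) h4.le
      _ = γ * (1 / T * a ^ 2) + 1 / (2 * T) * (b ^ 2 * γ) := by ring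
      _ ≤ 1 * (1 / T * a ^ 2) + 1 / (2 * T) * (2 * T) := by gcongr
      _ = 1 / T * a ^ 2 + 1 := by field_simp
  have ls := log_sum_le_integral (π := π) (f := fun q => gaussKernel T (q.1 - y))
    (g := fun q => gaussKernel T (q.2 - y)) (fun q => hγ0 q.1) (fun q => hγ0 q.2) ig1 ig2 ilog
    (integral_pos_of_pos (fun q => hγ0 q.1) ig1) (integral_pos_of_pos (fun q => hγ0 q.2) ig2)
  have iφ : Integrable (fun q : EuclideanSpace ℝ (Fin n) × EuclideanSpace ℝ (Fin n) =>
      φ q.1 * gaussKernel T (q.1 - y)) π := by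
    refine integrable_of_bounded (B := B) ((hφm.comp measurable_fst).mul hγm1) fun q => ?_
    rw [abs_mul, abs_of_pos (hγ0 _)]
    have := hB q.1
    have := hγ1 q.1
    nlinarith [hγ0 q.1, abs_nonneg (φ q.1)]
  have iD : Integrable (fun q : EuclideanSpace ℝ (Fin n) × EuclideanSpace ℝ (Fin n) =>
      ‖D q.1‖ ^ 2 * gaussKernel T (q.1 - y)) π := by
    refine integrable_of_bounded (B := G ^ 2)
      (((hDm.comp measurable_fst).norm.pow_const 2).mul hγm1) fun q => ?_
    rw [abs_mul, abs_of_pos (hγ0 _), abs_of_nonneg (by positivity)]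
    have h1 : ‖D q.1‖ ^ 2 ≤ G ^ 2 := pow_le_pow_left₀ (norm_nonneg _) (hG _) 2
    have := hγ1 q.1
    nlinarith [hγ0 q.1, sq_nonneg ‖D q.1‖]
  have e2l : 2 / (1 / (2 * T)) = 4 * T := by field_simp; ring
  rw [e2l] at lsi
  have efin : ∫ q : EuclideanSpace ℝ (Fin n) × EuclideanSpace ℝ (Fin n), gaussKernel T (q.1 - y) *
      ((φ q.1 - 4 * T * ‖D q.1‖ ^ 2 - 1 / (2 * T) * ‖q.2 - q.1‖ ^ 2)
        - inner ℝ ((1 / T) • (q.2 - q.1)) (q.1 - y)) ∂π =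
      (∫ q, φ q.1 * gaussKernel T (q.1 - y) ∂π) -
        4 * T * (∫ q, ‖D q.1‖ ^ 2 * gaussKernel T (q.1 - y) ∂π) -
        ∫ q, gaussKernel T (q.1 - y) * (Real.log (gaussKernel T (q.1 - y)) -
        Real.log (gaussKernel T (q.2 - y))) ∂π := by
    rw [← integral_const_mul, ← integral_sub_sub iφ (iD.const_mul _) ilog]
    refine integral_congr_ae (Filter.Eventually.of_forall fun q => ?_)
    simp only [elog q]
    ring
  rw [efin, sub_sub, sub_nonpos, add_comm]
  exact lsi.trans (add_le_add ls le_rfl)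

/-- HWI-type inequality: the entropy is bounded by the Fisher information and the cost of any
coupling. -/
theorem entropy_le_fisher_add_cost {W φ : EuclideanSpace ℝ (Fin n) → ℝ} (hWm : Measurable W)
    {K T : ℝ} (hW : IsModulusConvex K W) (hT : 0 < T) (hKT : 1 / (2 * T) ≤ K + 1 / T)
    {μ : Measure (EuclideanSpace ℝ (Fin n))} [IsProbabilityMeasure μ]
    (hμ : μ = volume.withDensity fun x => ENNReal.ofReal (Real.exp (-W x)))
    {D : EuclideanSpace ℝ (Fin n) → EuclideanSpace ℝ (Fin n)} (hφm : Measurable φ)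
    (hDm : Measurable D) {B G : ℝ} (hB : ∀ x, |φ x| ≤ B) (hG : ∀ x, ‖D x‖ ≤ G)
    (hφ : HasUniformTaylorBound φ D)
    {π : Measure (EuclideanSpace ℝ (Fin n) × EuclideanSpace ℝ (Fin n))} [IsProbabilityMeasure π]
    (hπ1 : π.map Prod.fst = μ.withDensity fun x => ENNReal.ofReal (Real.exp (φ x)))
    (hπ2 : π.map Prod.snd = μ) (hπ : Integrable (fun q => ‖q.2 - q.1‖ ^ 2) π) :
    ∫ x, φ x * Real.exp (φ x) ∂μ ≤ 4 * T * (∫ x, ‖D x‖ ^ 2 * Real.exp (φ x) ∂μ)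
      + 1 / (2 * T) * ∫ q, ‖q.2 - q.1‖ ^ 2 ∂π := by
  have tr1 : ∀ f : EuclideanSpace ℝ (Fin n) → ℝ, Measurable f →
      ∫ q, f q.1 ∂π = ∫ x, f x * Real.exp (φ x) ∂μ := by
    intro f hf
    rw [← integral_withDensity_ofReal hφm.exp (fun x => (Real.exp_pos _).le), ← hπ1,
      integral_map measurable_fst.aemeasurable hf.aestronglyMeasurable]
  have iφ : Integrable (fun q : EuclideanSpace ℝ (Fin n) × EuclideanSpace ℝ (Fin n) =>
      φ q.1) π := integrable_of_bounded (hφm.comp measurable_fst) fun q => hB q.1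
  have iD : Integrable (fun q : EuclideanSpace ℝ (Fin n) × EuclideanSpace ℝ (Fin n) =>
      ‖D q.1‖ ^ 2) π := by
    refine integrable_of_bounded (B := G ^ 2) ((hDm.comp measurable_fst).norm.pow_const 2)
      fun q => ?_
    rw [abs_of_nonneg (by positivity)]
    exact pow_le_pow_left₀ (norm_nonneg _) (hG _) 2
  have iw : Integrable (fun q : EuclideanSpace ℝ (Fin n) × EuclideanSpace ℝ (Fin n) =>
      (1 / T) • (q.2 - q.1)) π := by
    refine Integrable.smul (𝕜 := ℝ) (f := fun q : EuclideanSpace ℝ (Fin n) ×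
      EuclideanSpace ℝ (Fin n) => q.2 - q.1) (1 / T) ?_
    refine Integrable.mono' (hπ.add (integrable_const (1 : ℝ)))
      (measurable_snd.sub measurable_fst).aestronglyMeasurable
      (Filter.Eventually.of_forall fun q => ?_)
    simp only [Pi.add_apply]
    nlinarith [sq_nonneg (‖q.2 - q.1‖ - 1)]
  have iA := (iφ.sub (iD.const_mul (4 * T))).sub (hπ.const_mul (1 / (2 * T)))
  have main := integral_nonpos_of_gaussian_average (p := Prod.fst)
    (w := fun q => (1 / T) • (q.2 - q.1)) hT measurable_fst
    (by fun_prop) iA iw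
    (gaussian_average_nonpos hWm hW hT hKT hμ hφm hDm hB hG hφ hπ1 hπ2 hπ)
  simp only [Pi.sub_apply] at main
  rw [integral_sub_sub iφ (iD.const_mul (4 * T)) (hπ.const_mul (1 / (2 * T))), integral_const_mul, integral_const_mul,
    tr1 φ hφm, tr1 (fun x => ‖D x‖ ^ 2) (hDm.norm.pow_const 2)] at main
  linarith

end

theorem norm_gradient_eq {E : Type*} [NormedAddCommGroup E] [InnerProductSpace ℝ E]
    [CompleteSpace E] (f : E → ℝ) (x : E) : ‖gradient f x‖ = ‖fderiv ℝ f x‖ := by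
  rw [gradient, LinearIsometryEquiv.norm_map]

/-- A compactly supported `C¹` function, shifted by a constant, has a uniform Taylor bound. -/
theorem hasUniformTaylorBound_of_hasCompactSupport {E : Type*} [NormedAddCommGroup E]
    [InnerProductSpace ℝ E] [CompleteSpace E] {ψ : E → ℝ} (hψ : ContDiff ℝ 1 ψ)
    (hc : HasCompactSupport ψ) (c : ℝ) :
    HasUniformTaylorBound (fun x => ψ x + c) (gradient ψ) := by
  intro ε hε
  have hcont : Continuous (fderiv ℝ ψ) := hψ.continuous_fderiv (by norm_num)
  have hcs : HasCompactSupport (fderiv ℝ ψ) := hc.fderiv ℝ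
  obtain ⟨G, hG⟩ := hcs.exists_bound_of_continuous hcont
  obtain ⟨B, hB⟩ := hc.exists_bound_of_continuous hψ.continuous
  have huc := hcs.uniformContinuous_of_continuous hcont
  obtain ⟨η, hη, hd⟩ := Metric.uniformContinuous_iff.1 huc ε hε
  have hB0 : 0 ≤ B := (norm_nonneg _).trans (hB 0)
  have hG0 : 0 ≤ G := (norm_nonneg _).trans (hG 0)
  refine ⟨2 * B / η ^ 2 + G / η, by positivity, fun z h => ?_⟩
  have e : inner ℝ (gradient ψ z) h = fderiv ℝ ψ z h := by
    rw [gradient, InnerProductSpace.toDual_symm_apply]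
  rw [e]
  simp only
  rcases lt_or_ge ‖h‖ η with hlt | hge
  · have key := (convex_ball z η).norm_image_sub_le_of_norm_fderiv_le' (𝕜 := ℝ) (f := ψ)
      (φ := fderiv ℝ ψ z) (C := ε) (x := z) (y := z + h)
      (fun x _ => (hψ.differentiable (by norm_num)) x)
      (fun x hx => by
        rw [← dist_eq_norm]
        exact (hd (by simpa using hx)).le) (by simpa using hη) (by simpa using hlt)
    rw [add_sub_cancel_left] at key
    have := (Real.le_norm_self _).trans key
    have : 0 ≤ (2 * B / η ^ 2 + G / η) * ‖h‖ ^ 2 := by positivity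
    linarith
  · have h1 := (Real.le_norm_self _).trans (hB (z + h))
    have h2 := (neg_le_abs _).trans (hB z)
    have h3 := (neg_le_abs _).trans (((fderiv ℝ ψ z).le_opNorm h).trans
      (mul_le_mul_of_nonneg_right (hG z) (norm_nonneg h)))
    have h4 : 2 * B ≤ 2 * B / η ^ 2 * ‖h‖ ^ 2 := by
      rw [div_mul_eq_mul_div, le_div_iff₀ (by positivity)]
      gcongr
    have h5 : G * ‖h‖ ≤ G / η * ‖h‖ ^ 2 := by
      rw [div_mul_eq_mul_div, le_div_iff₀ hη, sq, ← mul_assoc]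
      gcongr
    have h6 : 0 ≤ ε * ‖h‖ := by positivity
    linarith

theorem fisherInfo_le {n : ℕ} {μ : Measure (EuclideanSpace ℝ (Fin n))}
    {φ : EuclideanSpace ℝ (Fin n) → ℝ} (hφ : Differentiable ℝ φ) :
    fisherInfo (μ.withDensity fun x => ENNReal.ofReal (Real.exp (φ x))) μ ≤
      ∫⁻ x, ENNReal.ofReal (1 / 4 * (‖fderiv ℝ φ x‖ ^ 2 * Real.exp (φ x))) ∂μ := by
  have hs : (fun x => Real.sqrt (Real.exp (φ x))) = fun x => Real.exp (1 / 2 * φ x) := by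
    ext x
    rw [Real.sqrt_eq_iff_mul_self_eq (Real.exp_pos _).le (Real.exp_pos _).le, ← Real.exp_add]
    ring_nf
  have hd : ∀ x, HasFDerivAt (fun x => Real.exp (1 / 2 * φ x))
      (Real.exp (1 / 2 * φ x) • ((1 / 2 : ℝ) • fderiv ℝ φ x)) x := fun x =>
    ((hφ x).hasFDerivAt.const_mul (1 / 2)).exp
  refine (iInf_le_of_le (fun x => Real.exp (φ x)) <| iInf_le_of_le (fun x => (Real.exp_pos _).le) <|
    iInf_le_of_le rfl <| iInf_le_of_le ?_ (lintegral_mono fun x => ?_))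
  · rw [hs]; exact fun x => (hd x).differentiableAt
  · rw [hs]
    have e : (‖gradient (fun y => Real.exp (1 / 2 * φ y)) x‖₊ : ℝ≥0∞) =
        ENNReal.ofReal ‖gradient (fun y => Real.exp (1 / 2 * φ y)) x‖ :=
      (ofReal_norm _).symm
    rw [e, ← ENNReal.ofReal_pow (norm_nonneg _), norm_gradient_eq, (hd x).fderiv, norm_smul,
      norm_smul, Real.norm_of_nonneg (Real.exp_pos _).le,
      Real.norm_of_nonneg (by norm_num : (0 : ℝ) ≤ 1 / 2)]
    refine ENNReal.ofReal_le_ofReal (le_of_eq ?_)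
    have : Real.exp (φ x) = Real.exp (1 / 2 * φ x) ^ 2 := by
      rw [← Real.exp_nat_mul]; push_cast; ring_nf
    rw [this]; ring

section
variable {n : ℕ}

/-- A transport-information inequality controls the entropy of smooth positive densities. -/
theorem entropy_le_of_transport_information {W : EuclideanSpace ℝ (Fin n) → ℝ} (hWm : Measurable W)
    {K T : ℝ} (hW : IsModulusConvex K W) (hT : 0 < T) (hKT : 1 / (2 * T) ≤ K + 1 / T)
    {μ : Measure (EuclideanSpace ℝ (Fin n))} [IsProbabilityMeasure μ]
    (hμ : μ = volume.withDensity fun x => ENNReal.ofReal (Real.exp (-W x)))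
    {C α : ℝ} (hC : 0 < C) (hα : 0 < α)
    (hW2I : ∀ ν : Measure (EuclideanSpace ℝ (Fin n)), IsProbabilityMeasure ν →
      wassersteinDist 2 ν μ ^ 2 ≤ ENNReal.ofReal C * fisherInfo ν μ ^ α)
    {ψ : EuclideanSpace ℝ (Fin n) → ℝ} (hψ : ContDiff ℝ 1 ψ) (hc : HasCompactSupport ψ) {c : ℝ}
    (h1 : ∫ x, Real.exp (ψ x + c) ∂μ = 1) {A : ℝ}
    (hA : 1 / 4 * ∫ x, ‖fderiv ℝ ψ x‖ ^ 2 * Real.exp (ψ x + c) ∂μ ≤ A) :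
    ∫ x, (ψ x + c) * Real.exp (ψ x + c) ∂μ ≤ 16 * T * A + C / (2 * T) * A ^ α := by
  set φ : EuclideanSpace ℝ (Fin n) → ℝ := fun x => ψ x + c with hφdef
  have hφc : ContDiff ℝ 1 φ := hψ.add contDiff_const
  have hcont : Continuous (fderiv ℝ ψ) := hψ.continuous_fderiv (by norm_num)
  have hfd : ∀ x, fderiv ℝ φ x = fderiv ℝ ψ x := fun x => by rw [hφdef, fderiv_add_const]
  obtain ⟨G, hG⟩ := (hc.fderiv ℝ).exists_bound_of_continuous hcont
  obtain ⟨B, hB⟩ := hc.exists_bound_of_continuous hψ.continuous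
  have hφB : ∀ x, |φ x| ≤ B + |c| := fun x => (abs_add_le _ _).trans (by gcongr; exact hB x)
  have hφm : Measurable φ := hφc.continuous.measurable
  have hem : Measurable fun x => Real.exp (φ x) := hφm.exp
  have he : ∀ x, Real.exp (φ x) ≤ Real.exp (B + |c|) := fun x =>
    Real.exp_le_exp.2 ((le_abs_self _).trans (hφB x))
  have ie : Integrable (fun x => Real.exp (φ x)) μ :=
    integrable_of_bounded (B := Real.exp (B + |c|)) hem fun x => by
      rw [abs_of_pos (Real.exp_pos _)]; exact he x
  have iI : Integrable (fun x => ‖fderiv ℝ ψ x‖ ^ 2 * Real.exp (φ x)) μ :=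
    integrable_of_bounded (B := G ^ 2 * Real.exp (B + |c|))
      ((hcont.norm.pow 2).measurable.mul hem) fun x => by
      rw [abs_of_nonneg (by positivity)]
      exact mul_le_mul (pow_le_pow_left₀ (norm_nonneg _) (hG x) 2) (he x) (Real.exp_pos _).le
        (by positivity)
  have hA0 : 0 ≤ A := le_trans (mul_nonneg (by norm_num)
    (integral_nonneg fun x => by positivity)) hA
  set ν := μ.withDensity fun x => ENNReal.ofReal (Real.exp (φ x)) with hν
  have hνp : IsProbabilityMeasure ν := by
    constructor
    rw [hν, withDensity_apply _ MeasurableSet.univ, Measure.restrict_univ,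
      ← ofReal_integral_eq_lintegral_ofReal ie
        (Filter.Eventually.of_forall fun x => (Real.exp_pos _).le), h1, ENNReal.ofReal_one]
  have hF : fisherInfo ν μ ≤ ENNReal.ofReal A := by
    refine (fisherInfo_le (hφc.differentiable (by norm_num))).trans ?_
    simp only [hfd]
    rw [← ofReal_integral_eq_lintegral_ofReal (iI.const_mul _)
      (Filter.Eventually.of_forall fun x => by positivity), integral_const_mul]
    exact ENNReal.ofReal_le_ofReal hA
  have hWd : (⨅ (π : Measure (EuclideanSpace ℝ (Fin n) × EuclideanSpace ℝ (Fin n)))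
      (_ : IsCoupling π ν μ), ∫⁻ q, edist q.1 q.2 ^ (2 : ℝ) ∂π) ≤ ENNReal.ofReal (C * A ^ α) := by
    have := hW2I ν hνp
    rw [wassersteinDist, ← ENNReal.rpow_natCast, ← ENNReal.rpow_mul,
      show (1 / (2 : ℝ)) * ((2 : ℕ) : ℝ) = 1 by norm_num, ENNReal.rpow_one] at this
    refine this.trans ?_
    rw [ENNReal.ofReal_mul hC.le, ← ENNReal.ofReal_rpow_of_nonneg hA0 hα.le]
    gcongr
  refine le_of_forall_pos_le_add fun η hη => ?_
  have hlt : (⨅ (π : Measure (EuclideanSpace ℝ (Fin n) × EuclideanSpace ℝ (Fin n)))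
      (_ : IsCoupling π ν μ), ∫⁻ q, edist q.1 q.2 ^ (2 : ℝ) ∂π) <
      ENNReal.ofReal (C * A ^ α + 2 * T * η) :=
    hWd.trans_lt ((ENNReal.ofReal_lt_ofReal_iff (by positivity)).2
      (lt_add_of_pos_right _ (by positivity)))
  simp only [iInf_lt_iff] at hlt
  obtain ⟨π, ⟨hπ1, hπ2⟩, hπ⟩ := hlt
  have hπp : IsProbabilityMeasure π := by
    constructor
    have := congrArg (fun m => m Set.univ) hπ2
    simpa [Measure.map_apply measurable_snd MeasurableSet.univ] using this
  have hmeas : Measurable fun q : EuclideanSpace ℝ (Fin n) × EuclideanSpace ℝ (Fin n) =>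
      ‖q.2 - q.1‖ ^ 2 := by fun_prop
  have hed : ∀ q : EuclideanSpace ℝ (Fin n) × EuclideanSpace ℝ (Fin n),
      edist q.1 q.2 ^ (2 : ℝ) = ENNReal.ofReal (‖q.2 - q.1‖ ^ 2) := by
    intro q
    rw [edist_comm, edist_dist, dist_eq_norm, ENNReal.ofReal_rpow_of_nonneg (norm_nonneg _) (by norm_num)]
    norm_num
  simp only [hed] at hπ
  have iπ : Integrable (fun q : EuclideanSpace ℝ (Fin n) × EuclideanSpace ℝ (Fin n) =>
      ‖q.2 - q.1‖ ^ 2) π := by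
    refine (lintegral_ofReal_ne_top_iff_integrable hmeas.aestronglyMeasurable
      (Filter.Eventually.of_forall fun q => by positivity)).1 (ne_top_of_lt hπ)
  rw [← ofReal_integral_eq_lintegral_ofReal iπ
    (Filter.Eventually.of_forall fun q => by positivity),
    ENNReal.ofReal_lt_ofReal_iff (by positivity)] at hπ
  have hgm : Measurable (gradient ψ) :=
    ((InnerProductSpace.toDual ℝ (EuclideanSpace ℝ (Fin n))).symm.continuous.comp hcont).measurable
  have main := entropy_le_fisher_add_cost hWm hW hT hKT hμ hφm hgm hφB
    (fun x => (norm_gradient_eq ψ x).le.trans (hG x))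
    (hasUniformTaylorBound_of_hasCompactSupport hψ hc c) hπ1 hπ2 iπ
  simp only [norm_gradient_eq] at main
  refine main.trans ?_
  have e1 : 4 * T * ∫ x, ‖fderiv ℝ ψ x‖ ^ 2 * Real.exp (φ x) ∂μ ≤ 16 * T * A := by
    have := mul_le_mul_of_nonneg_left hA (by positivity : (0 : ℝ) ≤ 16 * T)
    linarith
  have e2 : 1 / (2 * T) * ∫ q : EuclideanSpace ℝ (Fin n) × EuclideanSpace ℝ (Fin n),
      ‖q.2 - q.1‖ ^ 2 ∂π ≤ C / (2 * T) * A ^ α + η := by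
    refine (mul_le_mul_of_nonneg_left hπ.le (by positivity)).trans (le_of_eq ?_)
    field_simp
  linarith

end

section
variable {E : Type*} [NormedAddCommGroup E] [InnerProductSpace ℝ E]

section
variable [MeasurableSpace E] [BorelSpace E]

/-- The entropy of `k ^ 2` is bounded through `Φ` by the energy of `k`, for bounded `C¹` functions
of finite energy. -/
def HasEntropyBound (μ : Measure E) (Φ : ℝ → ℝ) : Prop :=
  ∀ k : E → ℝ, ContDiff ℝ 1 k → (∃ M, ∀ x, |k x| ≤ M) →
    Integrable (fun x => ‖fderiv ℝ k x‖ ^ 2) μ → 0 < ∫ x, k x ^ 2 ∂μ →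
    ∫ x, k x ^ 2 * Real.log (k x ^ 2) ∂μ - (∫ x, k x ^ 2 ∂μ) * Real.log (∫ x, k x ^ 2 ∂μ) ≤
      (∫ x, k x ^ 2 ∂μ) * Φ ((∫ x, ‖fderiv ℝ k x‖ ^ 2 ∂μ) / ∫ x, k x ^ 2 ∂μ)

theorem entropy_le_of_hasCompactSupport {μ : Measure E} [IsProbabilityMeasure μ] {Φ : ℝ → ℝ}
    (hbase : ∀ ψ : E → ℝ, ContDiff ℝ 1 ψ → HasCompactSupport ψ → ∀ c,
      ∫ x, Real.exp (ψ x + c) ∂μ = 1 → ∀ A,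
      1 / 4 * ∫ x, ‖fderiv ℝ ψ x‖ ^ 2 * Real.exp (ψ x + c) ∂μ ≤ A →
      ∫ x, (ψ x + c) * Real.exp (ψ x + c) ∂μ ≤ Φ A)
    {u : E → ℝ} (hu : ContDiff ℝ 1 u) (hc : HasCompactSupport u) {ε : ℝ} (hε : 0 < ε) {N : ℝ}
    (hN : N = ∫ x, (u x ^ 2 + ε ^ 2) ∂μ) :
    ∫ x, (u x ^ 2 + ε ^ 2) * Real.log (u x ^ 2 + ε ^ 2) ∂μ - N * Real.log N ≤
      N * Φ ((∫ x, ‖fderiv ℝ u x‖ ^ 2 ∂μ) / N) := by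
  obtain ⟨M, hM⟩ := hc.exists_bound_of_continuous hu.continuous
  have hF0 : ∀ x, 0 < u x ^ 2 + ε ^ 2 := fun x => by positivity
  have hFc : ContDiff ℝ 1 fun x => u x ^ 2 + ε ^ 2 := (hu.pow 2).add contDiff_const
  have hFM : ∀ x, u x ^ 2 + ε ^ 2 ≤ M ^ 2 + ε ^ 2 := fun x => by
    have := pow_le_pow_left₀ (norm_nonneg _) (hM x) 2
    rw [Real.norm_eq_abs, sq_abs] at this
    linarith
  have iF : Integrable (fun x => u x ^ 2 + ε ^ 2) μ :=
    integrable_of_bounded hFc.continuous.measurable fun x => by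
      rw [abs_of_pos (hF0 x)]; exact hFM x
  have hNpos : 0 < N := by rw [hN]; exact integral_pos_of_pos hF0 iF
  set ψ : E → ℝ := fun x => Real.log (u x ^ 2 + ε ^ 2) - Real.log (ε ^ 2) with hψdef
  have hψ : ContDiff ℝ 1 ψ := (hFc.log fun x => (hF0 x).ne').sub contDiff_const
  have hψc : HasCompactSupport ψ :=
    hc.comp_left (g := fun s => Real.log (s ^ 2 + ε ^ 2) - Real.log (ε ^ 2)) (by simp)
  have hexp : ∀ x, ψ x + (Real.log (ε ^ 2) - Real.log N) =
      Real.log (u x ^ 2 + ε ^ 2) - Real.log N := fun x => by simp only [hψdef]; ring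
  have hexp2 : ∀ x, Real.exp (ψ x + (Real.log (ε ^ 2) - Real.log N)) = (u x ^ 2 + ε ^ 2) / N := by
    intro x
    rw [hexp, Real.exp_sub, Real.exp_log (hF0 x), Real.exp_log hNpos]
  have hfd : ∀ x, fderiv ℝ ψ x = (u x ^ 2 + ε ^ 2)⁻¹ • ((2 * u x) • fderiv ℝ u x) := by
    intro x
    have h1 : HasFDerivAt (fun x => u x ^ 2 + ε ^ 2) ((2 * u x) • fderiv ℝ u x) x := by
      have := ((hu.differentiable (by norm_num) x).hasFDerivAt.pow 2).add_const (ε ^ 2)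
      simpa using this
    exact ((h1.log (hF0 x).ne').sub_const _).fderiv
  have h1 : ∫ x, Real.exp (ψ x + (Real.log (ε ^ 2) - Real.log N)) ∂μ = 1 := by
    simp only [hexp2]
    rw [integral_div, ← hN, div_self hNpos.ne']
  have hcont : Continuous (fderiv ℝ u) := hu.continuous_fderiv (by norm_num)
  obtain ⟨G, hG⟩ := (hc.fderiv ℝ).exists_bound_of_continuous hcont
  have iJ : Integrable (fun x => ‖fderiv ℝ u x‖ ^ 2) μ :=
    integrable_of_bounded (B := G ^ 2) (hcont.norm.pow 2).measurable fun x => by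
      rw [abs_of_nonneg (by positivity)]
      exact pow_le_pow_left₀ (norm_nonneg _) (hG x) 2
  have key := hbase ψ hψ hψc _ h1 ((∫ x, ‖fderiv ℝ u x‖ ^ 2 ∂μ) / N) (by
    simp only [hexp2]
    rw [← integral_const_mul, ← integral_div]
    refine integral_mono_of_nonneg (Filter.Eventually.of_forall fun x => ?_) (iJ.div_const N)
      (Filter.Eventually.of_forall fun x => ?_)
    · have := hF0 x
      simp only [Pi.zero_apply]
      positivity
    · simp only
      rw [hfd, norm_smul, norm_smul, Real.norm_of_nonneg (inv_nonneg.2 (hF0 x).le), mul_pow,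
        mul_pow, Real.norm_eq_abs, sq_abs, ← mul_div_assoc, ← mul_div_assoc]
      refine div_le_div_of_nonneg_right ?_ hNpos.le
      have e : 1 / 4 * ((u x ^ 2 + ε ^ 2)⁻¹ ^ 2 * ((2 * u x) ^ 2 * ‖fderiv ℝ u x‖ ^ 2) *
          (u x ^ 2 + ε ^ 2)) = u x ^ 2 / (u x ^ 2 + ε ^ 2) * ‖fderiv ℝ u x‖ ^ 2 := by
        have := (hF0 x).ne'
        field_simp; ring
      rw [e]
      refine mul_le_of_le_one_left (by positivity) ((div_le_one (hF0 x)).2 ?_)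
      have := sq_nonneg ε
      linarith)
  simp only [hexp2] at key
  have e : ∫ x, (ψ x + (Real.log (ε ^ 2) - Real.log N)) * ((u x ^ 2 + ε ^ 2) / N) ∂μ =
      (∫ x, (u x ^ 2 + ε ^ 2) * Real.log (u x ^ 2 + ε ^ 2) ∂μ - N * Real.log N) / N := by
    have e1 : ∀ x, (ψ x + (Real.log (ε ^ 2) - Real.log N)) * ((u x ^ 2 + ε ^ 2) / N) =
        ((u x ^ 2 + ε ^ 2) * Real.log (u x ^ 2 + ε ^ 2) - (u x ^ 2 + ε ^ 2) * Real.log N) / N :=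
      fun x => by rw [hexp]; ring
    have iL : Integrable (fun x => (u x ^ 2 + ε ^ 2) * Real.log (u x ^ 2 + ε ^ 2)) μ := by
      have hψB := hψc.exists_bound_of_continuous hψ.continuous
      obtain ⟨B, hB⟩ := hψB
      refine integrable_of_bounded (B := (M ^ 2 + ε ^ 2) * (B + |Real.log (ε ^ 2)|))
        (hFc.continuous.measurable.mul hFc.continuous.measurable.log) fun x => ?_
      rw [abs_mul, abs_of_pos (hF0 x)]
      have e2 : Real.log (u x ^ 2 + ε ^ 2) = ψ x + Real.log (ε ^ 2) := by simp only [hψdef]; ring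
      rw [e2]
      refine mul_le_mul (hFM x) ((abs_add_le _ _).trans ?_) (abs_nonneg _) (by positivity)
      have := hB x
      rw [Real.norm_eq_abs] at this
      linarith
    simp only [e1]
    rw [integral_div, integral_sub iL (iF.mul_const _), integral_mul_const, ← hN]
  rw [e, div_le_iff₀ hNpos] at key
  linarith

end

variable [FiniteDimensional ℝ E]

/-- Smooth cutoff functions with uniformly bounded derivatives. -/
theorem exists_cutoff : ∃ (χ : ℕ → E → ℝ) (c : ℝ), 0 ≤ c ∧ ∀ j, ContDiff ℝ 1 (χ j) ∧
    HasCompactSupport (χ j) ∧ (∀ x, |χ j x| ≤ 1) ∧ (∀ x, ‖fderiv ℝ (χ j) x‖ ≤ c) ∧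
    ∀ x, ‖x‖ < j → χ j x = 1 := by
  let f : ContDiffBump (0 : E) := ⟨1, 2, by norm_num, by norm_num⟩
  have hf : ContDiff ℝ 1 (f : E → ℝ) := f.contDiff
  obtain ⟨c, hc⟩ := (f.hasCompactSupport.fderiv ℝ).exists_bound_of_continuous
    (hf.continuous_fderiv (by norm_num))
  refine ⟨fun j x => f (((j : ℝ) + 1)⁻¹ • x), c, (norm_nonneg _).trans (hc 0), fun j => ?_⟩
  have hj : (0 : ℝ) < (j : ℝ) + 1 := by positivity
  refine ⟨hf.comp (contDiff_const_smul _), ?_, fun x => ?_, fun x => ?_, fun x hx => ?_⟩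
  · exact f.hasCompactSupport.comp_smul (inv_ne_zero hj.ne')
  · rw [abs_of_nonneg f.nonneg]; exact f.le_one
  · have h1 : HasFDerivAt (fun x : E => ((j : ℝ) + 1)⁻¹ • x)
        (((j : ℝ) + 1)⁻¹ • ContinuousLinearMap.id ℝ E) x := (hasFDerivAt_id x).const_smul _
    have h2 := ((hf.differentiable (by norm_num)) (((j : ℝ) + 1)⁻¹ • x)).hasFDerivAt.comp x h1
    have h3 : fderiv ℝ (fun x => f (((j : ℝ) + 1)⁻¹ • x)) x = _ := h2.fderiv
    rw [h3, ContinuousLinearMap.comp_smul, ContinuousLinearMap.comp_id, norm_smul,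
      Real.norm_of_nonneg (by positivity)]
    refine (mul_le_of_le_one_left (norm_nonneg _) ?_).trans (hc _)
    exact inv_le_one_of_one_le₀ (by linarith [(Nat.cast_nonneg j : (0 : ℝ) ≤ j)])
  · refine f.one_of_mem_closedBall ?_
    rw [mem_closedBall_zero_iff, norm_smul, Real.norm_of_nonneg (by positivity)]
    change _ ≤ (1 : ℝ)
    rw [inv_mul_le_iff₀ hj]
    linarith

variable [MeasurableSpace E] [BorelSpace E]

theorem hasEntropyBound_of_exp {μ : Measure E} [IsProbabilityMeasure μ] {Φ : ℝ → ℝ}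
    (hΦ : Continuous Φ)
    (hbase : ∀ ψ : E → ℝ, ContDiff ℝ 1 ψ → HasCompactSupport ψ → ∀ c,
      ∫ x, Real.exp (ψ x + c) ∂μ = 1 → ∀ A,
      1 / 4 * ∫ x, ‖fderiv ℝ ψ x‖ ^ 2 * Real.exp (ψ x + c) ∂μ ≤ A →
      ∫ x, (ψ x + c) * Real.exp (ψ x + c) ∂μ ≤ Φ A) : HasEntropyBound μ Φ := by
  rintro k hk ⟨M, hM⟩ hI hN
  obtain ⟨χ, c, hc0, hχ⟩ := exists_cutoff (E := E)
  have hM0 : 0 ≤ M := (abs_nonneg _).trans (hM 0)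
  set u : ℕ → E → ℝ := fun j x => χ j x * k x with hu
  have huc : ∀ j, ContDiff ℝ 1 (u j) := fun j => (hχ j).1.mul hk
  have hucs : ∀ j, HasCompactSupport (u j) := fun j => (hχ j).2.1.mul_right
  have huM : ∀ j x, u j x ^ 2 ≤ M ^ 2 := fun j x => by
    rw [← sq_abs (u j x), hu]
    simp only [abs_mul]
    refine pow_le_pow_left₀ (by positivity) ?_ 2
    nlinarith [(hχ j).2.2.1 x, hM x, abs_nonneg (k x), abs_nonneg (χ j x)]
  set ε : ℕ → ℝ := fun j => 1 / ((j : ℝ) + 1) with hε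
  have hε0 : ∀ j, 0 < ε j := fun j => by positivity
  have hε1 : ∀ j, ε j ^ 2 ≤ 1 := fun j => by
    refine pow_le_one₀ (hε0 j).le ?_
    exact (div_le_one (by positivity)).2 (by linarith [(Nat.cast_nonneg j : (0 : ℝ) ≤ j)])
  have hεt : Filter.Tendsto ε Filter.atTop (nhds 0) := tendsto_one_div_add_atTop_nhds_zero_nat
  have hev : ∀ x : E, ∀ᶠ j : ℕ in Filter.atTop, u j =ᶠ[nhds x] k := fun x => by
    obtain ⟨J, hJ⟩ := exists_nat_gt ‖x‖
    filter_upwards [Filter.eventually_ge_atTop J] with j hj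
    have : ∀ᶠ y in nhds x, ‖y‖ < j :=
      continuous_norm.continuousAt.eventually_lt continuousAt_const
        (hJ.trans_le (by exact_mod_cast hj))
    filter_upwards [this] with y hy
    simp [hu, (hχ j).2.2.2.2 y hy]
  have hpt : ∀ x, Filter.Tendsto (fun j => u j x ^ 2 + ε j ^ 2) Filter.atTop (nhds (k x ^ 2)) := by
    intro x
    have h1 : Filter.Tendsto (fun j => k x ^ 2 + ε j ^ 2) Filter.atTop (nhds (k x ^ 2 + 0 ^ 2)) :=
      (hεt.pow 2).const_add _
    rw [zero_pow two_ne_zero, add_zero] at h1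
    refine h1.congr' ?_
    filter_upwards [hev x] with j hj
    rw [hj.eq_of_nhds]
  have hFm : ∀ j, Measurable fun x => u j x ^ 2 + ε j ^ 2 := fun j =>
    ((huc j).continuous.pow 2).measurable.add_const _
  have hFIcc : ∀ j x, u j x ^ 2 + ε j ^ 2 ∈ Set.Icc 0 (M ^ 2 + 1) := fun j x =>
    ⟨by positivity, add_le_add (huM j x) (hε1 j)⟩
  have tN : Filter.Tendsto (fun j => ∫ x, (u j x ^ 2 + ε j ^ 2) ∂μ) Filter.atTop
      (nhds (∫ x, k x ^ 2 ∂μ)) :=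
    tendsto_integral_of_dominated_convergence (fun _ => M ^ 2 + 1)
      (fun j => (hFm j).aestronglyMeasurable) (integrable_const _)
      (fun j => Filter.Eventually.of_forall fun x => by
        rw [Real.norm_of_nonneg (hFIcc j x).1]; exact (hFIcc j x).2)
      (Filter.Eventually.of_forall hpt)
  obtain ⟨B, hB⟩ := (isCompact_Icc (a := (0 : ℝ)) (b := M ^ 2 + 1)).exists_bound_of_continuousOn
    Real.continuous_mul_log.continuousOn
  have tH : Filter.Tendsto (fun j => ∫ x, (u j x ^ 2 + ε j ^ 2) * Real.log (u j x ^ 2 + ε j ^ 2) ∂μ)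
      Filter.atTop (nhds (∫ x, k x ^ 2 * Real.log (k x ^ 2) ∂μ)) :=
    tendsto_integral_of_dominated_convergence (fun _ => B)
      (fun j => ((hFm j).mul (hFm j).log).aestronglyMeasurable) (integrable_const _)
      (fun j => Filter.Eventually.of_forall fun x => hB _ (hFIcc j x))
      (Filter.Eventually.of_forall fun x =>
        (Real.continuous_mul_log.tendsto _).comp (hpt x))
  have hkc : Continuous (fderiv ℝ k) := hk.continuous_fderiv (by norm_num)
  have tJ : Filter.Tendsto (fun j => ∫ x, ‖fderiv ℝ (u j) x‖ ^ 2 ∂μ) Filter.atTop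
      (nhds (∫ x, ‖fderiv ℝ k x‖ ^ 2 ∂μ)) := by
    refine tendsto_integral_of_dominated_convergence
      (fun x => 2 * ‖fderiv ℝ k x‖ ^ 2 + 2 * (M * c) ^ 2)
      (fun j => (((huc j).continuous_fderiv (by norm_num)).norm.pow 2).aestronglyMeasurable)
      ((hI.const_mul 2).add (integrable_const _))
      (fun j => Filter.Eventually.of_forall fun x => ?_)
      (Filter.Eventually.of_forall fun x => ?_)
    · rw [Real.norm_of_nonneg (by positivity)]
      have e : fderiv ℝ (u j) x = χ j x • fderiv ℝ k x + k x • fderiv ℝ (χ j) x :=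
        (((hχ j).1.differentiable (by norm_num) x).hasFDerivAt.mul
          (hk.differentiable (by norm_num) x).hasFDerivAt).fderiv
      have h1 : ‖fderiv ℝ (u j) x‖ ≤ ‖fderiv ℝ k x‖ + M * c := by
        rw [e]
        refine (norm_add_le _ _).trans (add_le_add ?_ ?_)
        · rw [norm_smul]
          exact mul_le_of_le_one_left (norm_nonneg _) ((hχ j).2.2.1 x)
        · rw [norm_smul]
          exact mul_le_mul (hM x) ((hχ j).2.2.2.1 x) (norm_nonneg _) hM0
      have h2 := pow_le_pow_left₀ (norm_nonneg _) h1 2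
      nlinarith [sq_nonneg (‖fderiv ℝ k x‖ - M * c)]
    · refine tendsto_const_nhds.congr' ?_
      filter_upwards [hev x] with j hj
      rw [hj.fderiv_eq]
  have key : ∀ j, _ := fun j => entropy_le_of_hasCompactSupport hbase (huc j) (hucs j) (hε0 j) rfl
  refine le_of_tendsto_of_tendsto' (tH.sub (tN.mul ((Real.continuousAt_log hN.ne').tendsto.comp tN)))
    (tN.mul ((hΦ.tendsto _).comp (tJ.div tN hN.ne'))) key

end

theorem exists_median {α : Type*} [MeasurableSpace α] {μ : Measure α} [IsProbabilityMeasure μ]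
    {h : α → ℝ} (hh : Measurable h) {M : ℝ} (hM : ∀ x, |h x| ≤ M) :
    ∃ m, |m| ≤ M ∧ μ.real {x | m < h x} ≤ 1 / 2 ∧ μ.real {x | h x < m} ≤ 1 / 2 := by
  have hne : Nonempty α := μ.nonempty_of_neZero
  have hM0 : 0 ≤ M := (abs_nonneg _).trans (hM hne.some)
  set S : Set ℝ := {t | 1 / 2 ≤ μ.real {x | h x ≤ t}} with hS
  have hMS : M ∈ S := by
    have : {x | h x ≤ M} = Set.univ := Set.eq_univ_of_forall fun x => (le_abs_self _).trans (hM x)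
    rw [hS, Set.mem_ofPred_eq, this, probReal_univ]; norm_num
  have hlow : ∀ t ∈ S, -M ≤ t := by
    intro t ht
    by_contra! hlt
    have : {x | h x ≤ t} = ∅ := Set.eq_empty_of_forall_notMem fun x hx => by
      have := (abs_le.1 (hM x)).1
      have hx' : h x ≤ t := hx
      linarith
    rw [hS, Set.mem_ofPred_eq, this] at ht
    norm_num at ht
  have hbdd : BddBelow S := ⟨-M, hlow⟩
  have hms : ∀ t, MeasurableSet {x | h x ≤ t} := fun t => measurableSet_le hh measurable_const
  have hε : Filter.Tendsto (fun j : ℕ => 1 / ((j : ℝ) + 1)) Filter.atTop (nhds 0) :=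
    tendsto_one_div_add_atTop_nhds_zero_nat
  refine ⟨sInf S, abs_le.2 ⟨le_csInf ⟨M, hMS⟩ hlow, csInf_le hbdd hMS⟩, ?_, ?_⟩
  · have t1 : Filter.Tendsto (fun j : ℕ => ∫ x, Set.indicator {x | h x ≤ sInf S + 1 / ((j : ℝ) + 1)}
        (fun _ => (1 : ℝ)) x ∂μ) Filter.atTop
        (nhds (∫ x, Set.indicator {x | h x ≤ sInf S} (fun _ => (1 : ℝ)) x ∂μ)) := by
      refine tendsto_integral_of_dominated_convergence (fun _ => 1)
        (fun j => (measurable_const.indicator (hms _)).aestronglyMeasurable) (integrable_const _)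
        (fun j => Filter.Eventually.of_forall fun x => ?_)
        (Filter.Eventually.of_forall fun x => ?_)
      · simp only [Set.indicator]; split_ifs <;> simp
      · refine tendsto_const_nhds.congr' ?_
        by_cases hx : h x ≤ sInf S
        · refine Filter.Eventually.of_forall fun j => ?_
          have : h x ≤ sInf S + 1 / ((j : ℝ) + 1) := hx.trans (le_add_of_nonneg_right (by positivity))
          simp only [one_div] at this
          simp [Set.indicator, hx, this]
        · push Not at hx
          have h1 := hε.eventually (gt_mem_nhds (sub_pos.2 hx))
          filter_upwards [h1] with j hj
          have h2 : ¬ h x ≤ sInf S + 1 / ((j : ℝ) + 1) := by linarith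
          rw [Set.indicator_of_notMem (s := {x | h x ≤ sInf S}) (by simpa using hx),
            Set.indicator_of_notMem (s := {x | h x ≤ sInf S + 1 / ((j : ℝ) + 1)}) h2]
    have h1 : (1 / 2 : ℝ) ≤ ∫ x, Set.indicator {x | h x ≤ sInf S} (fun _ => (1 : ℝ)) x ∂μ := by
      refine ge_of_tendsto' t1 fun j => ?_
      rw [integral_indicator_const _ (hms _), smul_eq_mul, mul_one]
      obtain ⟨s, hs, hlt⟩ := exists_lt_of_csInf_lt ⟨M, hMS⟩
        (lt_add_of_pos_right (sInf S) (by positivity : (0 : ℝ) < 1 / ((j : ℝ) + 1)))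
      exact le_trans hs (measureReal_mono fun x hx => le_trans hx hlt.le)
    rw [integral_indicator_const _ (hms _), smul_eq_mul, mul_one] at h1
    have e : {x | sInf S < h x} = {x | h x ≤ sInf S}ᶜ := by ext x; simp
    rw [e, probReal_compl_eq_one_sub (hms _)]
    linarith
  · have t1 : Filter.Tendsto (fun j : ℕ => ∫ x, Set.indicator {x | h x ≤ sInf S - 1 / ((j : ℝ) + 1)}
        (fun _ => (1 : ℝ)) x ∂μ) Filter.atTop
        (nhds (∫ x, Set.indicator {x | h x < sInf S} (fun _ => (1 : ℝ)) x ∂μ)) := by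
      refine tendsto_integral_of_dominated_convergence (fun _ => 1)
        (fun j => (measurable_const.indicator (hms _)).aestronglyMeasurable) (integrable_const _)
        (fun j => Filter.Eventually.of_forall fun x => ?_)
        (Filter.Eventually.of_forall fun x => ?_)
      · simp only [Set.indicator]; split_ifs <;> simp
      · refine tendsto_const_nhds.congr' ?_
        by_cases hx : h x < sInf S
        · have h1 := hε.eventually (gt_mem_nhds (sub_pos.2 hx))
          filter_upwards [h1] with j hj
          have h2 : h x ≤ sInf S - 1 / ((j : ℝ) + 1) := by linarith
          rw [Set.indicator_of_mem (s := {x | h x < sInf S}) hx,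
            Set.indicator_of_mem (s := {x | h x ≤ sInf S - 1 / ((j : ℝ) + 1)}) h2]
        · refine Filter.Eventually.of_forall fun j => ?_
          have h2 : ¬ h x ≤ sInf S - 1 / ((j : ℝ) + 1) := by
            have : (0 : ℝ) < 1 / ((j : ℝ) + 1) := by positivity
            push Not at hx ⊢
            linarith
          rw [Set.indicator_of_notMem (s := {x | h x < sInf S}) hx]
          exact (Set.indicator_of_notMem (s := {x | h x ≤ sInf S - 1 / ((j : ℝ) + 1)}) h2 _).symm
    have h1 : ∫ x, Set.indicator {x | h x < sInf S} (fun _ => (1 : ℝ)) x ∂μ ≤ 1 / 2 := by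
      refine le_of_tendsto' t1 fun j => ?_
      rw [integral_indicator_const _ (hms _), smul_eq_mul, mul_one]
      by_contra! hlt
      have := csInf_le hbdd (show sInf S - 1 / ((j : ℝ) + 1) ∈ S from hlt.le)
      have : (0 : ℝ) < 1 / ((j : ℝ) + 1) := by positivity
      linarith
    rwa [integral_indicator_const _ (measurableSet_lt hh measurable_const), smul_eq_mul,
      mul_one] at h1

/-- A smooth approximation of the positive part, up to rescaling. -/
theorem exists_smooth_posPart : ∃ (ρ : ℕ → ℝ → ℝ) (c : ℝ), 0 < c ∧ (∀ j, ContDiff ℝ 1 (ρ j)) ∧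
    (∀ j s, |deriv (ρ j) s| ≤ c) ∧ (∀ j s, s ≤ 0 → ρ j s = 0) ∧ (∀ j s, |ρ j s| ≤ |s|) ∧
    ∀ s, Filter.Tendsto (fun j => ρ j s) Filter.atTop (nhds (max s 0)) := by
  set θ : ℝ → ℝ := fun y => y * Real.smoothTransition y with hθ
  have hθc : ContDiff ℝ 1 θ := contDiff_id.mul Real.smoothTransition.contDiff
  obtain ⟨B, hB⟩ := (isCompact_Icc (a := (0 : ℝ)) (b := 1)).exists_bound_of_continuousOn
    (hθc.continuous_deriv (by norm_num)).continuousOn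
  have hd : ∀ y, |deriv θ y| ≤ max B 1 := by
    intro y
    rcases lt_or_ge y 0 with h0 | h0
    · have : θ =ᶠ[nhds y] fun _ => 0 := by
        filter_upwards [Iio_mem_nhds h0] with z hz
        simp [hθ, Real.smoothTransition.zero_of_nonpos (le_of_lt hz)]
      rw [this.deriv_eq]; simp
    rcases le_or_gt y 1 with h1 | h1
    · exact (hB y ⟨h0, h1⟩).trans (le_max_left _ _)
    · have : θ =ᶠ[nhds y] fun z => z := by
        filter_upwards [Ioi_mem_nhds h1] with z hz
        simp [hθ, Real.smoothTransition.one_of_one_le (le_of_lt hz)]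
      rw [this.deriv_eq]; simp
  have hj : ∀ j : ℕ, (0 : ℝ) < (j : ℝ) + 1 := fun j => by positivity
  refine ⟨fun j s => s * Real.smoothTransition (((j : ℝ) + 1) * s), max B 1, by positivity,
    fun j => ?_, fun j s => ?_, fun j s hs => ?_, fun j s => ?_, fun s => ?_⟩
  · exact contDiff_id.mul (Real.smoothTransition.contDiff.comp (contDiff_const.mul contDiff_id))
  · have e : (fun s => s * Real.smoothTransition (((j : ℝ) + 1) * s)) =
        fun s => ((j : ℝ) + 1)⁻¹ * θ (((j : ℝ) + 1) * s) := by
      ext s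
      have := (hj j).ne'
      simp only [hθ]
      field_simp
    have h1 : HasDerivAt (fun s => ((j : ℝ) + 1)⁻¹ * θ (((j : ℝ) + 1) * s))
        (deriv θ (((j : ℝ) + 1) * s)) s := by
      have h2 : HasDerivAt (fun s => ((j : ℝ) + 1) * s) ((j : ℝ) + 1) s := by
        simpa using (hasDerivAt_id s).const_mul ((j : ℝ) + 1)
      have h3 := (((hθc.differentiable (by norm_num)) (((j : ℝ) + 1) * s)).hasDerivAt.comp s
        h2).const_mul ((j : ℝ) + 1)⁻¹
      refine h3.congr_deriv ?_
      have := (hj j).ne'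
      field_simp
    simp only [e]
    rw [h1.deriv]
    exact hd _
  · simp [Real.smoothTransition.zero_of_nonpos (mul_nonpos_of_nonneg_of_nonpos (hj j).le hs)]
  · simp only
    rw [abs_mul, abs_of_nonneg (Real.smoothTransition.nonneg _)]
    exact mul_le_of_le_one_right (abs_nonneg _) (Real.smoothTransition.le_one _)
  · rcases le_or_gt s 0 with hs | hs
    · rw [max_eq_right hs]
      refine tendsto_const_nhds.congr fun j => ?_
      simp [Real.smoothTransition.zero_of_nonpos (mul_nonpos_of_nonneg_of_nonpos (hj j).le hs)]
    · rw [max_eq_left hs.le]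
      refine tendsto_const_nhds.congr' ?_
      obtain ⟨J, hJ⟩ := exists_nat_gt (1 / s)
      filter_upwards [Filter.eventually_ge_atTop J] with j hjJ
      have h1 : (1 : ℝ) ≤ ((j : ℝ) + 1) * s := by
        rw [← div_le_iff₀ hs]
        have : (J : ℝ) ≤ j := by exact_mod_cast hjJ
        linarith
      rw [Real.smoothTransition.one_of_one_le h1, mul_one]

section
variable {E : Type*} [NormedAddCommGroup E] [InnerProductSpace ℝ E] [MeasurableSpace E]
  [BorelSpace E]

theorem mul_log_ge {a b : ℝ} (ha : 0 ≤ a) (hb : 0 < b) :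
    a * Real.log b + a - b ≤ a * Real.log a := by
  rcases ha.eq_or_lt with rfl | ha
  · simp [hb.le]
  · have h1 := Real.log_le_sub_one_of_pos (div_pos hb ha)
    rw [Real.log_div hb.ne' ha.ne'] at h1
    have h2 := mul_le_mul_of_nonneg_left h1 ha.le
    have h3 : a * (b / a - 1) = b - a := by field_simp
    rw [h3] at h2
    linarith

theorem integrable_mul_log {α : Type*} [MeasurableSpace α] {μ : Measure α} [IsFiniteMeasure μ]
    {f : α → ℝ} (hf : Measurable f) (hf0 : ∀ x, 0 ≤ f x) {M : ℝ} (hM : ∀ x, f x ≤ M) :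
    Integrable (fun x => f x * Real.log (f x)) μ := by
  obtain ⟨B, hB⟩ := (isCompact_Icc (a := (0 : ℝ)) (b := M)).exists_bound_of_continuousOn
    Real.continuous_mul_log.continuousOn
  exact integrable_of_bounded (hf.mul hf.log) fun x => hB _ ⟨hf0 x, hM x⟩

/-- Functions supported on a set of measure at most one half satisfy a Poincaré inequality. -/
theorem HasEntropyBound.le_of_support {μ : Measure E} [IsProbabilityMeasure μ] {Φ : ℝ → ℝ}
    (hM : HasEntropyBound μ Φ) {c : ℝ} (hc : ∀ A, 0 ≤ A → A < c → Φ A < Real.log 2)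
    {k : E → ℝ} (hk : ContDiff ℝ 1 k) (hkb : ∃ M, ∀ x, |k x| ≤ M)
    (hI : Integrable (fun x => ‖fderiv ℝ k x‖ ^ 2) μ) {S : Set E} (hS : MeasurableSet S)
    (hμS : μ.real S ≤ 1 / 2) (hkS : ∀ x ∉ S, k x = 0) :
    c * ∫ x, k x ^ 2 ∂μ ≤ ∫ x, ‖fderiv ℝ k x‖ ^ 2 ∂μ := by
  have hI0 : 0 ≤ ∫ x, ‖fderiv ℝ k x‖ ^ 2 ∂μ := integral_nonneg fun x => by positivity
  have hkm : Measurable k := hk.continuous.measurable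
  obtain ⟨M, hkM⟩ := hkb
  have hk2 : ∀ x, k x ^ 2 ≤ M ^ 2 := fun x => by
    rw [← sq_abs (k x)]; exact pow_le_pow_left₀ (abs_nonneg _) (hkM x) 2
  have ik : Integrable (fun x => k x ^ 2) μ := integrable_of_bounded (B := M ^ 2) (hkm.pow_const 2)
    fun x => by rw [abs_of_nonneg (sq_nonneg _)]; exact hk2 x
  rcases (integral_nonneg fun x => sq_nonneg (k x) : 0 ≤ ∫ x, k x ^ 2 ∂μ).eq_or_lt with h0 | hN
  · rw [← h0, mul_zero]; exact hI0
  set N := ∫ x, k x ^ 2 ∂μ with hNdef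
  have key := hM k hk ⟨M, hkM⟩ hI hN
  have hlow : N * Real.log (2 * N) + N - 2 * N * μ.real S ≤
      ∫ x, k x ^ 2 * Real.log (k x ^ 2) ∂μ := by
    have iS : Integrable (S.indicator fun _ => 2 * N) μ := (integrable_const _).indicator hS
    have e : ∫ x, (k x ^ 2 * Real.log (2 * N) + k x ^ 2 - S.indicator (fun _ => 2 * N) x) ∂μ =
        N * Real.log (2 * N) + N - 2 * N * μ.real S := by
      rw [integral_sub (f := fun x => k x ^ 2 * Real.log (2 * N) + k x ^ 2)
        ((ik.mul_const _).add ik) iS, integral_add (ik.mul_const _) ik, integral_mul_const,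
        integral_indicator_const _ hS, smul_eq_mul, mul_comm (μ.real S)]
    rw [← e]
    refine integral_mono (((ik.mul_const _).add ik).sub iS)
      (integrable_mul_log (hkm.pow_const 2) (fun x => sq_nonneg _) hk2) fun x => ?_
    by_cases hx : x ∈ S
    · simp only [Set.indicator_of_mem hx]
      exact mul_log_ge (sq_nonneg _) (by positivity)
    · simp [Set.indicator_of_notMem hx, hkS x hx]
  rw [Real.log_mul two_ne_zero hN.ne'] at hlow
  have h1 : N * Real.log 2 ≤ N * Φ ((∫ x, ‖fderiv ℝ k x‖ ^ 2 ∂μ) / N) := by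
    nlinarith
  have h2 := le_of_mul_le_mul_left h1 hN
  by_contra! hlt
  have h3 := hc _ (div_nonneg hI0 hN.le) ((div_lt_iff₀ hN).2 hlt)
  linarith

theorem HasEntropyBound.posPart_le {μ : Measure E} [IsProbabilityMeasure μ] {Φ : ℝ → ℝ}
    (hM : HasEntropyBound μ Φ) {c : ℝ} (hc : ∀ A, 0 ≤ A → A < c → Φ A < Real.log 2) :
    ∃ L, 0 < L ∧ ∀ h : E → ℝ, ContDiff ℝ 1 h → (∃ M, ∀ x, |h x| ≤ M) →
      Integrable (fun x => ‖fderiv ℝ h x‖ ^ 2) μ → μ.real {x | 0 < h x} ≤ 1 / 2 →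
      c * ∫ x, max (h x) 0 ^ 2 ∂μ ≤ L * ∫ x, ‖fderiv ℝ h x‖ ^ 2 ∂μ := by
  obtain ⟨ρ, B, hB0, hρ, hρd, hρ0, hρa, hρt⟩ := exists_smooth_posPart
  refine ⟨B ^ 2, by positivity, ?_⟩
  rintro h hh ⟨M, hhM⟩ hI hμ
  have hfd : ∀ j x, fderiv ℝ (fun x => ρ j (h x)) x = deriv (ρ j) (h x) • fderiv ℝ h x :=
    fun j x => ((((hρ j).differentiable (by norm_num)) (h x)).hasDerivAt.comp_hasFDerivAt x
      ((hh.differentiable (by norm_num)) x).hasFDerivAt).fderiv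
  have hle : ∀ j x, ‖fderiv ℝ (fun x => ρ j (h x)) x‖ ^ 2 ≤ B ^ 2 * ‖fderiv ℝ h x‖ ^ 2 := by
    intro j x
    rw [hfd, norm_smul, mul_pow]
    gcongr
    exact hρd j _
  have hcd : ∀ j, ContDiff ℝ 1 fun x => ρ j (h x) := fun j => (hρ j).comp hh
  have hIj : ∀ j, Integrable (fun x => ‖fderiv ℝ (fun x => ρ j (h x)) x‖ ^ 2) μ := fun j =>
    Integrable.mono' (hI.const_mul (B ^ 2))
      (((hcd j).continuous_fderiv (by norm_num)).norm.pow 2).measurable.aestronglyMeasurable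
      (Filter.Eventually.of_forall fun x => by
        rw [Real.norm_of_nonneg (by positivity)]; exact hle j x)
  have hS : MeasurableSet {x | 0 < h x} := measurableSet_lt measurable_const hh.continuous.measurable
  have t : Filter.Tendsto (fun j => c * ∫ x, ρ j (h x) ^ 2 ∂μ) Filter.atTop
      (nhds (c * ∫ x, max (h x) 0 ^ 2 ∂μ)) := by
    refine Filter.Tendsto.const_mul _ (tendsto_integral_of_dominated_convergence (fun _ => M ^ 2)
      (fun j => ((hcd j).continuous.pow 2).measurable.aestronglyMeasurable) (integrable_const _)
      (fun j => Filter.Eventually.of_forall fun x => ?_)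
      (Filter.Eventually.of_forall fun x => (hρt (h x)).pow 2))
    rw [Real.norm_of_nonneg (sq_nonneg _), ← sq_abs (ρ j (h x))]
    exact pow_le_pow_left₀ (abs_nonneg _) ((hρa j _).trans (hhM x)) 2
  refine le_of_tendsto' t fun j => ?_
  refine (hM.le_of_support hc (hcd j) ⟨M, fun x => (hρa j _).trans (hhM x)⟩ (hIj j) hS hμ
    fun x hx => hρ0 j _ (by simpa using hx)).trans ?_
  rw [← integral_const_mul]
  exact integral_mono (hIj j) (hI.const_mul _) (hle j)

/-- Poincaré inequality around a suitable constant. -/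
theorem HasEntropyBound.exists_poincare {μ : Measure E} [IsProbabilityMeasure μ] {Φ : ℝ → ℝ}
    (hM : HasEntropyBound μ Φ) {c : ℝ} (hc0 : 0 < c)
    (hc : ∀ A, 0 ≤ A → A < c → Φ A < Real.log 2) :
    ∃ P, 0 < P ∧ ∀ h : E → ℝ, ContDiff ℝ 1 h → (∃ M, ∀ x, |h x| ≤ M) →
      Integrable (fun x => ‖fderiv ℝ h x‖ ^ 2) μ →
      ∃ m, ∫ x, (h x - m) ^ 2 ∂μ ≤ P * ∫ x, ‖fderiv ℝ h x‖ ^ 2 ∂μ := by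
  obtain ⟨L, hL, hpos⟩ := hM.posPart_le hc
  refine ⟨2 * L / c, by positivity, ?_⟩
  rintro h hh ⟨M, hhM⟩ hI
  obtain ⟨m, hm, hm1, hm2⟩ := exists_median (μ := μ) hh.continuous.measurable hhM
  have f1 : ∀ x, fderiv ℝ (fun x => h x - m) x = fderiv ℝ h x := fun x => by
    rw [fderiv_sub_const]
  have f2 : ∀ x, fderiv ℝ (fun x => m - h x) x = -fderiv ℝ h x := fun x => by
    rw [fderiv_const_sub]
  have b1 : ∀ x, |h x - m| ≤ M + M := fun x => (abs_sub _ _).trans (add_le_add (hhM x) hm)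
  have p1 := hpos (fun x => h x - m) (hh.sub contDiff_const) ⟨M + M, b1⟩
    (by simpa only [f1] using hI) (by simpa only [sub_pos] using hm1)
  have p2 := hpos (fun x => m - h x) (contDiff_const.sub hh)
    ⟨M + M, fun x => by rw [abs_sub_comm]; exact b1 x⟩
    (by simpa only [f2, norm_neg] using hI) (by simpa only [sub_pos] using hm2)
  simp only [f1] at p1
  simp only [f2, norm_neg] at p2
  have hb : ∀ a : ℝ, |a| ≤ M + M → max a 0 ^ 2 ≤ (M + M) ^ 2 := fun a ha =>
    pow_le_pow_left₀ (le_max_right _ _)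
      (max_le ((le_abs_self a).trans ha) ((abs_nonneg a).trans ha)) 2
  have hmeas := hh.continuous.measurable
  have i1 : Integrable (fun x => max (h x - m) 0 ^ 2) μ :=
    integrable_of_bounded (B := (M + M) ^ 2) (by fun_prop) fun x => by
      rw [abs_of_nonneg (sq_nonneg _)]; exact hb _ (b1 x)
  have i2 : Integrable (fun x => max (m - h x) 0 ^ 2) μ :=
    integrable_of_bounded (B := (M + M) ^ 2) (by fun_prop) fun x => by
      rw [abs_of_nonneg (sq_nonneg _)]
      exact hb _ (by rw [abs_sub_comm]; exact b1 x)
  refine ⟨m, ?_⟩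
  have e : ∫ x, (h x - m) ^ 2 ∂μ =
      (∫ x, max (h x - m) 0 ^ 2 ∂μ) + ∫ x, max (m - h x) 0 ^ 2 ∂μ := by
    rw [← integral_add i1 i2]
    refine integral_congr_ae (Filter.Eventually.of_forall fun x => ?_)
    simp only
    rcases le_total (h x) m with hx | hx
    · rw [max_eq_right (sub_nonpos.2 hx), max_eq_left (sub_nonneg.2 hx)]; ring
    · rw [max_eq_left (sub_nonneg.2 hx), max_eq_right (sub_nonpos.2 hx)]; ring
  rw [e, div_mul_eq_mul_div, le_div_iff₀ hc0]
  linarith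

end

section
variable {E : Type*} [NormedAddCommGroup E] [InnerProductSpace ℝ E] [MeasurableSpace E]
  [BorelSpace E]

theorem sq_mul_log_sq_le {h κ : ℝ} (hh : 0 ≤ h) (hκ : 0 < κ) (hκ1 : κ ≤ 1) :
    h ^ 2 * Real.log (h ^ 2) - h ^ 2 + 1 ≤ 10 * (h - 1) ^ 2 +
      4 * ((h - 1) ^ 2 * Real.log ((h - 1) ^ 2) - (h - 1) ^ 2 * Real.log κ - (h - 1) ^ 2 + κ) := by
  rcases le_total h 2 with h2 | h2
  · have h1 := mul_log_ge (sq_nonneg (h - 1)) hκ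
    have h3 : h ^ 2 * Real.log (h ^ 2) ≤ h ^ 2 * (h ^ 2 - 1) := by
      rcases hh.eq_or_lt with rfl | h0
      · simp
      · exact mul_le_mul_of_nonneg_left (Real.log_le_sub_one_of_pos (by positivity))
          (sq_nonneg h)
    have h4 : (h - 1) ^ 2 * (h + 1) ^ 2 ≤ (h - 1) ^ 2 * 9 :=
      mul_le_mul_of_nonneg_left (by nlinarith) (sq_nonneg _)
    nlinarith [sq_nonneg (h - 1)]
  · set k := h - 1 with hk
    have hk1 : 1 ≤ k := by linarith
    have hk2 : 0 < k ^ 2 := by positivity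
    have h1 : h ^ 2 ≤ 4 * k ^ 2 := by nlinarith
    have h3 : h ^ 2 * Real.log (h ^ 2) ≤ 4 * k ^ 2 * Real.log (4 * k ^ 2) :=
      mul_le_mul h1 (Real.log_le_log (by positivity) h1) (Real.log_nonneg (by nlinarith))
        (by positivity)
    have h4 : Real.log 4 ≤ 1.4 := by
      have : Real.log 4 = 2 * Real.log 2 := by
        rw [show (4 : ℝ) = 2 ^ 2 by norm_num, Real.log_pow]; norm_num
      linarith [Real.log_two_lt_d9]
    rw [Real.log_mul (by norm_num) hk2.ne'] at h3
    have h5 := mul_nonneg hk2.le (neg_nonneg.2 (Real.log_nonpos hκ.le hκ1))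
    have h6 := mul_le_mul_of_nonneg_left h4 hk2.le
    nlinarith

theorem rpow_le_one_add {A α : ℝ} (hA : 0 ≤ A) (hα : 0 < α) (hα1 : α ≤ 1) : A ^ α ≤ 1 + A := by
  rcases le_total A 1 with h | h
  · exact (Real.rpow_le_one hA h hα.le).trans (by linarith)
  · exact (Real.rpow_le_rpow_of_exponent_le h hα1).trans (by rw [Real.rpow_one]; linarith)

/-- A power entropy bound implies a logarithmic Sobolev inequality. -/
theorem HasEntropyBound.exists_logSobolev {μ : Measure E} [IsProbabilityMeasure μ] {a b α : ℝ}
    (ha : 0 ≤ a) (hb : 0 ≤ b) (hα : 0 < α) (hα1 : α ≤ 1)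
    (hM : HasEntropyBound μ fun A => a * A + b * A ^ α) :
    ∃ L, 0 < L ∧ ∀ h : E → ℝ, ContDiff ℝ 1 h → (∀ x, 0 ≤ h x) → (∃ M, ∀ x, |h x| ≤ M) →
      Integrable (fun x => ‖fderiv ℝ h x‖ ^ 2) μ → ∫ x, h x ^ 2 ∂μ = 1 →
      ∫ x, h x ^ 2 * Real.log (h x ^ 2) ∂μ ≤ L * ∫ x, ‖fderiv ℝ h x‖ ^ 2 ∂μ := by
  have hcont : Continuous fun A : ℝ => a * A + b * A ^ α :=
    (continuous_const.mul continuous_id).add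
      (continuous_const.mul (Real.continuous_rpow_const hα.le))
  have hlin : ∀ A : ℝ, 0 ≤ A → a * A + b * A ^ α ≤ (a + b) * A + b := fun A hA => by
    have := mul_le_mul_of_nonneg_left (rpow_le_one_add hA hα hα1) hb
    linarith
  obtain ⟨c, hc0, hc⟩ : ∃ c > 0, ∀ A : ℝ, 0 ≤ A → A < c → a * A + b * A ^ α < Real.log 2 := by
    have h0 : (fun A : ℝ => a * A + b * A ^ α) 0 < Real.log 2 := by
      simpa [Real.zero_rpow hα.ne'] using Real.log_pos (by norm_num : (1 : ℝ) < 2)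
    obtain ⟨c, hc0, hc⟩ := Metric.eventually_nhds_iff.1 (hcont.continuousAt.eventually_lt
      continuousAt_const h0)
    exact ⟨c, hc0, fun A hA hAc => hc (by rwa [Real.dist_eq, sub_zero, abs_of_nonneg hA])⟩
  obtain ⟨P, hP, hpoin⟩ := hM.exists_poincare hc0 hc
  refine ⟨20 * P + 4 * (a + b) + 8 * b * P, by positivity, ?_⟩
  rintro h hh h0 ⟨M, hhM⟩ hI h1
  obtain ⟨m, hm⟩ := hpoin h hh ⟨M, hhM⟩ hI
  set I := ∫ x, ‖fderiv ℝ h x‖ ^ 2 ∂μ with hIdef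
  have hI0 : 0 ≤ I := integral_nonneg fun x => by positivity
  have hhm : Measurable h := hh.continuous.measurable
  have ih : Integrable h μ := integrable_of_bounded hhm hhM
  have hsq : ∀ x, h x ^ 2 ≤ M ^ 2 := fun x => by
    rw [← sq_abs (h x)]; exact pow_le_pow_left₀ (abs_nonneg _) (hhM x) 2
  have ih2 : Integrable (fun x => h x ^ 2) μ :=
    integrable_of_bounded (B := M ^ 2) (hhm.pow_const 2)
      fun x => by rw [abs_of_nonneg (sq_nonneg _)]; exact hsq x
  have hexp : ∀ t : ℝ, ∫ x, (h x - t) ^ 2 ∂μ = 1 - 2 * t * ∫ x, h x ∂μ + t ^ 2 := fun t => by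
    have : ∀ x, (h x - t) ^ 2 = h x ^ 2 - 2 * t * h x + t ^ 2 := fun x => by ring
    simp only [this]
    rw [integral_add (f := fun x => h x ^ 2 - 2 * t * h x) (ih2.sub (ih.const_mul _))
      (integrable_const _), integral_sub (f := fun x => h x ^ 2) ih2 (ih.const_mul _),
      integral_const_mul, h1]
    simp
  have iks : ∀ t : ℝ, Integrable (fun x => (h x - t) ^ 2) μ := fun t => by
    have : ∀ x, (h x - t) ^ 2 = h x ^ 2 - 2 * t * h x + t ^ 2 := fun x => by ring
    simp only [this]
    exact (ih2.sub (ih.const_mul _)).add (integrable_const _)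
  set κ := ∫ x, (h x - 1) ^ 2 ∂μ with hκdef
  have hκ0 : 0 ≤ κ := integral_nonneg fun x => sq_nonneg _
  have hκP : κ ≤ 2 * P * I := by
    have e1 := hexp 1
    rw [← hκdef] at e1
    rw [hexp m] at hm
    have hs0 : 0 ≤ ∫ x, h x ∂μ := integral_nonneg h0
    nlinarith [sq_nonneg (m - ∫ x, h x ∂μ)]
  have ihl : Integrable (fun x => h x ^ 2 * Real.log (h x ^ 2)) μ :=
    integrable_mul_log (hhm.pow_const 2) (fun x => sq_nonneg _) hsq
  rcases hκ0.eq_or_lt with hκz | hκpos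
  · have hae := (integral_eq_zero_iff_of_nonneg (fun x => sq_nonneg (h x - 1)) (iks 1)).1 hκz.symm
    have : ∫ x, h x ^ 2 * Real.log (h x ^ 2) ∂μ = 0 := by
      rw [integral_eq_zero_of_ae]
      filter_upwards [hae] with x hx
      have hx1 : h x = 1 := by
        have := pow_eq_zero_iff (two_ne_zero) |>.1 hx
        linarith
      simp [hx1]
    rw [this]
    positivity
  rcases le_total κ 1 with hκ1 | hκ1
  · have hkM : ∀ x, (h x - 1) ^ 2 ≤ (M + 1) ^ 2 := fun x => by
      rw [← sq_abs (h x - 1)]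
      refine pow_le_pow_left₀ (abs_nonneg _) ((abs_sub _ _).trans ?_) 2
      simpa using hhM x
    have ikl : Integrable (fun x => (h x - 1) ^ 2 * Real.log ((h x - 1) ^ 2)) μ :=
      integrable_mul_log ((hhm.sub_const 1).pow_const 2) (fun x => sq_nonneg _) hkM
    have hf : ∀ x, fderiv ℝ (fun x => h x - 1) x = fderiv ℝ h x := fun x => by
      rw [fderiv_sub_const]
    have hEnt := hM (fun x => h x - 1) (hh.sub contDiff_const)
      ⟨M + 1, fun x => (abs_sub _ _).trans (by simpa using hhM x)⟩ (by simpa only [hf] using hI)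
      hκpos
    simp only [hf] at hEnt
    rw [← hIdef, ← hκdef] at hEnt
    have hEnt2 := hEnt.trans (mul_le_mul_of_nonneg_left (hlin (I / κ) (by positivity)) hκ0)
    have e2 : κ * ((a + b) * (I / κ) + b) = (a + b) * I + b * κ := by field_simp
    rw [e2] at hEnt2
    have iB : Integrable (fun x => (h x - 1) ^ 2 * Real.log ((h x - 1) ^ 2)
        - (h x - 1) ^ 2 * Real.log κ - (h x - 1) ^ 2 + κ) μ :=
      ((ikl.sub ((iks 1).mul_const _)).sub (iks 1)).add (integrable_const _)
    have hint := integral_mono (μ := μ)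
      (f := fun x => h x ^ 2 * Real.log (h x ^ 2) - h x ^ 2 + 1)
      (g := fun x => 10 * (h x - 1) ^ 2 + 4 * ((h x - 1) ^ 2 * Real.log ((h x - 1) ^ 2)
        - (h x - 1) ^ 2 * Real.log κ - (h x - 1) ^ 2 + κ))
      ((ihl.sub ih2).add (integrable_const _))
      (((iks 1).const_mul 10).add (iB.const_mul 4))
      fun x => sq_mul_log_sq_le (h0 x) hκpos hκ1
    rw [integral_add (f := fun x => h x ^ 2 * Real.log (h x ^ 2) - h x ^ 2) (ihl.sub ih2)
      (integrable_const _), integral_sub (f := fun x => h x ^ 2 * Real.log (h x ^ 2)) ihl ih2, h1,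
      integral_add (f := fun x => 10 * (h x - 1) ^ 2) ((iks 1).const_mul 10)
        (iB.const_mul 4),
      integral_const_mul, integral_const_mul,
      integral_add (f := fun x => (h x - 1) ^ 2 * Real.log ((h x - 1) ^ 2)
        - (h x - 1) ^ 2 * Real.log κ - (h x - 1) ^ 2)
        ((ikl.sub ((iks 1).mul_const _)).sub (iks 1)) (integrable_const _),
      integral_sub (f := fun x => (h x - 1) ^ 2 * Real.log ((h x - 1) ^ 2)
        - (h x - 1) ^ 2 * Real.log κ) (ikl.sub ((iks 1).mul_const _)) (iks 1),
      integral_sub (f := fun x => (h x - 1) ^ 2 * Real.log ((h x - 1) ^ 2)) ikl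
        ((iks 1).mul_const _), integral_mul_const, ← hκdef] at hint
    simp only [integral_const, probReal_univ, one_smul] at hint
    have e3 := mul_le_mul_of_nonneg_left hκP hb
    linarith
  · have hEnt := hM h hh ⟨M, hhM⟩ hI (by rw [h1]; norm_num)
    rw [h1, Real.log_one, mul_zero, sub_zero, one_mul, div_one, ← hIdef] at hEnt
    have e3 := mul_le_mul_of_nonneg_left (hκ1.trans hκP) hb
    have e4 := hlin I hI0
    have e5 : 0 ≤ (a + b) * I := by positivity
    have e6 : 0 ≤ P * I := by positivity
    have e7 : 0 ≤ b * (P * I) := by positivity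
    linarith

end

/-- The normalized regularization `√((g² + t²) / (1 + t²))` of `|g|` is `C¹` and does not increase
the energy density. -/
theorem contDiff_sqrt_regularization {E : Type*} [NormedAddCommGroup E] [InnerProductSpace ℝ E]
    {g : E → ℝ} (hg : ContDiff ℝ 1 g) {t : ℝ} (ht : 0 < t) :
    ContDiff ℝ 1 (fun x => √((g x ^ 2 + t ^ 2) / (1 + t ^ 2))) ∧
      ∀ x, ‖fderiv ℝ (fun x => √((g x ^ 2 + t ^ 2) / (1 + t ^ 2))) x‖ ≤ ‖fderiv ℝ g x‖ := by
  have hpos : ∀ x, 0 < (g x ^ 2 + t ^ 2) / (1 + t ^ 2) := fun x => by positivity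
  refine ⟨(((hg.pow 2).add contDiff_const).div_const _).sqrt fun x => (hpos x).ne', fun x => ?_⟩
  have hgd := ((hg.differentiable (by norm_num)) x).hasFDerivAt
  have h1 := ((((hgd.pow 2).add_const (t ^ 2)).mul_const (1 + t ^ 2)⁻¹).sqrt
    (by simpa [div_eq_mul_inv] using (hpos x).ne'))
  simp only [← div_eq_mul_inv] at h1
  rw [h1.fderiv]
  simp only [norm_smul, ← mul_assoc]
  refine mul_le_of_le_one_left (norm_nonneg _) ?_
  set s := √((g x ^ 2 + t ^ 2) / (1 + t ^ 2)) with hs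
  have hs0 : 0 < s := Real.sqrt_pos.2 (hpos x)
  have hs2 : s ^ 2 = (g x ^ 2 + t ^ 2) / (1 + t ^ 2) := Real.sq_sqrt (hpos x).le
  have hk : |g x| / (1 + t ^ 2) ≤ s := by
    refine (sq_le_sq₀ (by positivity) hs0.le).1 ?_
    rw [hs2, div_pow, sq_abs]
    refine div_le_div₀ (by positivity) (by linarith [sq_nonneg t]) (by positivity) ?_
    nlinarith [sq_nonneg t]
  have hn : (0 : ℝ) < 1 + t ^ 2 := by positivity
  have he : ‖1 / (2 * s)‖ * ‖(1 + t ^ 2)⁻¹‖ * ‖2 • g x ^ (2 - 1)‖ = |g x| / (1 + t ^ 2) / s := by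
    rw [Real.norm_of_nonneg (by positivity), Real.norm_of_nonneg (by positivity)]
    simp only [nsmul_eq_mul, Real.norm_eq_abs, abs_mul, Nat.add_one_sub_one, pow_one]
    norm_num
    field_simp
  rw [he]
  exact (div_le_one hs0).2 hk

theorem entropy_le_of_nonneg {E : Type*} [NormedAddCommGroup E] [InnerProductSpace ℝ E]
    [MeasurableSpace E] [BorelSpace E] {μ : Measure E} [IsProbabilityMeasure μ] {C p : ℝ} (hC : 0 ≤ C)
    (hp : 0 ≤ p)
    (hbound : ∀ h : E → ℝ, ContDiff ℝ 1 h → (∀ x, 0 ≤ h x) → (∃ M, ∀ x, |h x| ≤ M) →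
      Integrable (fun x => ‖fderiv ℝ h x‖ ^ 2) μ → ∫ x, h x ^ 2 ∂μ = 1 →
      ∫ x, h x ^ 2 * Real.log (h x ^ 2) ∂μ ≤ C * (∫ x, ‖fderiv ℝ h x‖ ^ 2 ∂μ) ^ p)
    {g : E → ℝ} (hg : ContDiff ℝ 1 g) (hgM : ∃ M, ∀ x, |g x| ≤ M)
    (hI : Integrable (fun x => ‖fderiv ℝ g x‖ ^ 2) μ) (h1 : ∫ x, g x ^ 2 ∂μ = 1) :
    ∫ x, g x ^ 2 * Real.log (g x ^ 2) ∂μ ≤ C * (∫ x, ‖fderiv ℝ g x‖ ^ 2 ∂μ) ^ p := by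
  obtain ⟨M, hM⟩ := hgM
  have hgm : Measurable g := hg.continuous.measurable
  have hsq : ∀ x, g x ^ 2 ≤ M ^ 2 := fun x => by
    rw [← sq_abs (g x)]; exact pow_le_pow_left₀ (abs_nonneg _) (hM x) 2
  have ig2 : Integrable (fun x => g x ^ 2) μ :=
    integrable_of_bounded (B := M ^ 2) (hgm.pow_const 2)
      fun x => by rw [abs_of_nonneg (sq_nonneg _)]; exact hsq x
  set t : ℕ → ℝ := fun j => 1 / ((j : ℝ) + 1) with ht
  have ht0 : ∀ j, 0 < t j := fun j => by positivity
  have ht1 : ∀ j, t j ≤ 1 := fun j => by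
    rw [ht]; exact (div_le_one (by positivity)).2 (by linarith [Nat.cast_nonneg (α := ℝ) j])
  have htl : Filter.Tendsto t Filter.atTop (nhds 0) := tendsto_one_div_add_atTop_nhds_zero_nat
  have hval : ∀ j x, √((g x ^ 2 + t j ^ 2) / (1 + t j ^ 2)) ^ 2
      = (g x ^ 2 + t j ^ 2) / (1 + t j ^ 2) := fun j x => Real.sq_sqrt (by positivity)
  have hup : ∀ j x, (g x ^ 2 + t j ^ 2) / (1 + t j ^ 2) ≤ M ^ 2 + 1 := fun j x => by
    rw [div_le_iff₀ (by positivity)]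
    nlinarith [hsq x, sq_nonneg (t j), sq_nonneg M, mul_nonneg (sq_nonneg M) (sq_nonneg (t j)),
      ht1 j, ht0 j]
  have hstep : ∀ j, ∫ x, (g x ^ 2 + t j ^ 2) / (1 + t j ^ 2) *
      Real.log ((g x ^ 2 + t j ^ 2) / (1 + t j ^ 2)) ∂μ
      ≤ C * (∫ x, ‖fderiv ℝ g x‖ ^ 2 ∂μ) ^ p := by
    intro j
    obtain ⟨hc, hd⟩ := contDiff_sqrt_regularization hg (ht0 j)
    have hd2 : ∀ x, ‖fderiv ℝ (fun x => √((g x ^ 2 + t j ^ 2) / (1 + t j ^ 2))) x‖ ^ 2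
        ≤ ‖fderiv ℝ g x‖ ^ 2 := fun x => pow_le_pow_left₀ (norm_nonneg _) (hd x) 2
    have hi : Integrable (fun x =>
        ‖fderiv ℝ (fun x => √((g x ^ 2 + t j ^ 2) / (1 + t j ^ 2))) x‖ ^ 2) μ := by
      refine hI.mono ((hc.continuous_fderiv (by norm_num)).norm.pow 2).measurable.aestronglyMeasurable
        (.of_forall fun x => ?_)
      rw [Real.norm_of_nonneg (sq_nonneg _), Real.norm_of_nonneg (sq_nonneg _)]
      exact hd2 x
    have hb := hbound _ hc (fun x => Real.sqrt_nonneg _) ⟨√(M ^ 2 + 1), fun x => by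
      rw [abs_of_nonneg (Real.sqrt_nonneg _)]; exact Real.sqrt_le_sqrt (hup j x)⟩ hi (by
        simp only [hval]
        rw [integral_div, integral_add ig2 (integrable_const _), h1]
        simp only [integral_const, probReal_univ, one_smul]
        exact div_self (by positivity))
    simp only [hval] at hb
    refine hb.trans (mul_le_mul_of_nonneg_left (Real.rpow_le_rpow
      (integral_nonneg fun x => sq_nonneg _) (integral_mono hi hI hd2) hp) hC)
  obtain ⟨B, hB⟩ := (isCompact_Icc (a := (0 : ℝ)) (b := M ^ 2 + 1)).exists_bound_of_continuousOn
    Real.continuous_mul_log.continuousOn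
  refine le_of_tendsto (tendsto_integral_of_dominated_convergence (fun _ => B)
    (fun j => ?_) (integrable_const _) (fun j => .of_forall fun x => hB _ ⟨by positivity, hup j x⟩)
    (.of_forall fun x => ?_)) (.of_forall hstep)
  · have : Measurable fun x => (g x ^ 2 + t j ^ 2) / (1 + t j ^ 2) :=
      ((hgm.pow_const 2).add_const _).div_const _
    exact (this.mul this.log).aestronglyMeasurable
  · have : Filter.Tendsto (fun j => (g x ^ 2 + t j ^ 2) / (1 + t j ^ 2)) Filter.atTop
        (nhds (g x ^ 2)) := by
      have h2 := (tendsto_const_nhds (x := g x ^ 2)).add (htl.pow 2)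
      have h3 := (tendsto_const_nhds (x := (1 : ℝ))).add (htl.pow 2)
      simpa [Pi.div_def] using h2.div h3 (by norm_num)
    exact (Real.continuous_mul_log.tendsto _).comp this

/-- **Corollary 4.2, converse part**: for `δ ∈ [1,2)`, if `Hess V` is bounded below
and `W₂(ν,μ)² ≤ C I(ν|μ)^{(2−δ)/δ}` for all probability measures `ν`, then
`μ(g² log g²)^δ ≤ C' μ(|∇g|²)` for some constant `C' > 0`. -/
theorem W2I_implies_power_logSobolev {n : ℕ}
    (V : EuclideanSpace ℝ (Fin n) → ℝ) (hV : ContDiff ℝ 2 V) (Z : ℝ) (hZ : 0 < Z)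
    (μ : Measure (EuclideanSpace ℝ (Fin n)))
    (hμ : μ = volume.withDensity fun x => ENNReal.ofReal (Real.exp (-V x) / Z))
    (hμprob : IsProbabilityMeasure μ)
    (hHess : ∃ K : ℝ, ∀ x v : EuclideanSpace ℝ (Fin n),
      K * ‖v‖ ^ 2 ≤ iteratedFDeriv ℝ 2 V x ![v, v])
    (δ : ℝ) (hδ₁ : 1 ≤ δ) (hδ₂ : δ < 2) (C : ℝ) (hC : 0 < C)
    (hW2I : ∀ ν : Measure (EuclideanSpace ℝ (Fin n)), IsProbabilityMeasure ν →
      wassersteinDist 2 ν μ ^ 2 ≤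
        ENNReal.ofReal C * fisherInfo ν μ ^ ((2 - δ) / δ)) :
    ∃ C' : ℝ, 0 < C' ∧
      ∀ g : EuclideanSpace ℝ (Fin n) → ℝ, ContDiff ℝ 1 g →
        (∃ M, ∀ x, |g x| ≤ M) → (∫ x, g x ^ 2 ∂μ) = 1 →
        ENNReal.ofReal ((∫ x, g x ^ 2 * Real.log (g x ^ 2) ∂μ) ^ δ) ≤
          ENNReal.ofReal C' * ∫⁻ x, (‖gradient g x‖₊ : ℝ≥0∞) ^ 2 ∂μ := by
  obtain ⟨K, hK⟩ := hHess
  have hδ0 : 0 < δ := by linarith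
  set α := (2 - δ) / δ with hαdef
  have hα : 0 < α := div_pos (by linarith) hδ0
  have hα1 : α ≤ 1 := (div_le_one hδ0).2 (by linarith)
  set W : EuclideanSpace ℝ (Fin n) → ℝ := fun x => V x + Real.log Z with hWdef
  have hWm : Measurable W := hV.continuous.measurable.add_const _
  have hW : IsModulusConvex K W := by
    simpa using (isModulusConvex_of_hessian hV hK).add_sq 0 (Real.log Z) 0
  have hμW : μ = volume.withDensity fun x => ENNReal.ofReal (Real.exp (-W x)) := by
    rw [hμ]
    congr with x
    rw [hWdef, neg_add, Real.exp_add, Real.exp_neg (Real.log Z), Real.exp_log hZ, div_eq_mul_inv]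
  set T₀ : ℝ := 1 / (2 * |K| + 2) with hT₀def
  have hT₀ : 0 < T₀ := by positivity
  have hent : ∀ T, 0 < T → T ≤ T₀ →
      HasEntropyBound μ fun A => 16 * T * A + C / (2 * T) * A ^ α := by
    intro T hT hTT
    have hKT : 1 / (2 * T) ≤ K + 1 / T := by
      have h1 : 2 * |K| + 2 ≤ 1 / T := by
        rw [le_div_iff₀ hT, mul_comm, ← le_div_iff₀ (by positivity)]
        exact hTT
      have h2 : 1 / (2 * T) = 1 / T / 2 := by field_simp
      rw [h2]
      linarith [neg_abs_le K]
    refine hasEntropyBound_of_exp ((continuous_const.mul continuous_id).add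
      (continuous_const.mul (Real.continuous_rpow_const hα.le))) ?_
    intro ψ hψ hc c h1 A hA
    exact entropy_le_of_transport_information hWm hW hT hKT hμW hC hα hW2I hψ hc h1 hA
  obtain ⟨L, hL, hLS⟩ := (hent T₀ hT₀ le_rfl).exists_logSobolev (by positivity) (by positivity)
    hα hα1
  set D := max L (16 * T₀ + C / (2 * T₀)) with hD
  have hD0 : 0 < D := hL.trans_le (le_max_left _ _)
  have hδinv : δ⁻¹ ≤ 1 := inv_le_one_of_one_le₀ hδ₁
  have hpos : ∀ h : EuclideanSpace ℝ (Fin n) → ℝ, ContDiff ℝ 1 h → (∀ x, 0 ≤ h x) →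
      (∃ M, ∀ x, |h x| ≤ M) → Integrable (fun x => ‖fderiv ℝ h x‖ ^ 2) μ →
      ∫ x, h x ^ 2 ∂μ = 1 →
      ∫ x, h x ^ 2 * Real.log (h x ^ 2) ∂μ ≤ D * (∫ x, ‖fderiv ℝ h x‖ ^ 2 ∂μ) ^ δ⁻¹ := by
    intro h hh h0 hM hI h1
    set I := ∫ x, ‖fderiv ℝ h x‖ ^ 2 ∂μ with hIdef
    have hI0 : 0 ≤ I := integral_nonneg fun x => by positivity
    rcases le_total I 1 with hI1 | hI1
    · refine (hLS h hh h0 hM hI h1).trans (mul_le_mul (le_max_left _ _) ?_ hI0 hD0.le)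
      calc I = I ^ (1 : ℝ) := (Real.rpow_one I).symm
        _ ≤ I ^ δ⁻¹ := Real.rpow_le_rpow_of_exponent_ge_of_imp hI0 hI1 hδinv
          fun _ hz => absurd hz (by positivity)
    · have hIpos : 0 < I := by linarith
      set r := I ^ ((α - 1) / 2) with hr
      have hr0 : 0 < r := Real.rpow_pos_of_pos hIpos _
      have hr1 : r ≤ 1 := Real.rpow_le_one_of_one_le_of_nonpos hI1 (by linarith)
      have hb := hent (T₀ * r) (by positivity) (mul_le_of_le_one_right hT₀.le hr1) h hh hM hI
        (by rw [h1]; norm_num)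
      rw [h1, Real.log_one, mul_zero, sub_zero, one_mul, div_one, ← hIdef] at hb
      have hexp : (1 + α) / 2 = δ⁻¹ := by rw [hαdef]; field_simp; ring
      have e1 : r * I = I ^ δ⁻¹ := by
        rw [← hexp, hr]
        nth_rewrite 2 [← Real.rpow_one I]
        rw [← Real.rpow_add hIpos]
        congr 1; ring
      have e2 : I ^ α / r = I ^ δ⁻¹ := by
        rw [← hexp, hr, ← Real.rpow_sub hIpos]
        congr 1; ring
      have e3 : 16 * (T₀ * r) * I + C / (2 * (T₀ * r)) * I ^ α
          = 16 * T₀ * (r * I) + C / (2 * T₀) * (I ^ α / r) := by field_simp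
      beta_reduce at hb
      rw [e3, e1, e2, ← add_mul] at hb
      exact hb.trans (mul_le_mul_of_nonneg_right (le_max_right _ _) (Real.rpow_nonneg hI0 _))
  refine ⟨D ^ δ, Real.rpow_pos_of_pos hD0 _, fun g hg hgM h1 => ?_⟩
  have hcont : Continuous fun x => ‖fderiv ℝ g x‖ ^ 2 :=
    (hg.continuous_fderiv (by norm_num)).norm.pow 2
  have hlint : ∫⁻ x, (‖gradient g x‖₊ : ℝ≥0∞) ^ 2 ∂μ
      = ∫⁻ x, ENNReal.ofReal (‖fderiv ℝ g x‖ ^ 2) ∂μ := by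
    refine lintegral_congr fun x => ?_
    rw [← norm_gradient_eq, ENNReal.ofReal_pow (norm_nonneg _), ofReal_norm]
    rfl
  rw [hlint]
  by_cases hI : Integrable (fun x => ‖fderiv ℝ g x‖ ^ 2) μ
  · rw [← ofReal_integral_eq_lintegral_ofReal hI (.of_forall fun x => sq_nonneg _),
      ← ENNReal.ofReal_mul (Real.rpow_nonneg hD0.le _)]
    refine ENNReal.ofReal_le_ofReal ?_
    have hI0 : 0 ≤ ∫ x, ‖fderiv ℝ g x‖ ^ 2 ∂μ := integral_nonneg fun x => sq_nonneg _
    have hH := entropy_le_of_nonneg hD0.le (by positivity) hpos hg hgM hI h1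
    have hH0 : 0 ≤ ∫ x, g x ^ 2 * Real.log (g x ^ 2) ∂μ := by
      obtain ⟨M, hM⟩ := hgM
      have hgm : Measurable fun x => g x ^ 2 := (hg.continuous.pow 2).measurable
      have hsq : ∀ x, g x ^ 2 ≤ M ^ 2 := fun x => by
        rw [← sq_abs (g x)]; exact pow_le_pow_left₀ (abs_nonneg _) (hM x) 2
      have ig2 : Integrable (fun x => g x ^ 2) μ := integrable_of_bounded (B := M ^ 2) hgm
        fun x => by rw [abs_of_nonneg (sq_nonneg _)]; exact hsq x
      have hmono := integral_mono (μ := μ) (f := fun x => g x ^ 2 - 1) (ig2.sub (integrable_const _))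
        (integrable_mul_log hgm (fun x => sq_nonneg _) hsq)
        fun x => by simpa using mul_log_ge (sq_nonneg (g x)) one_pos
      rw [integral_sub ig2 (integrable_const _), h1] at hmono
      simpa using hmono
    calc _ ≤ (D * (∫ x, ‖fderiv ℝ g x‖ ^ 2 ∂μ) ^ δ⁻¹) ^ δ := Real.rpow_le_rpow hH0 hH hδ0.le
      _ = _ := by
        rw [Real.mul_rpow hD0.le (Real.rpow_nonneg hI0 _), Real.rpow_inv_rpow hI0 hδ0.ne']
  · have htop : ∫⁻ x, ENNReal.ofReal (‖fderiv ℝ g x‖ ^ 2) ∂μ = ∞ := by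
      by_contra hne
      exact hI ⟨hcont.aestronglyMeasurable, (hasFiniteIntegral_iff_ofReal
        (.of_forall fun x => sq_nonneg _)).2 (lt_top_iff_ne_top.2 hne)⟩
    rw [htop, ENNReal.mul_top (by simpa using Real.rpow_pos_of_pos hD0 δ)]
    exact le_top
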